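/- arXiv:2505.03050 — 4 statements merged into one kernel-verified Lean document; each statement's English description precedes it below -/
import Mathlib

section
/- Let f : ℝⁿ → ℝ be C¹ with L-Lipschitz gradient on all of ℝⁿ, and let (x^k) be IGDm iterates with X = ℝⁿ, parameters satisfying max{Lτ, 2Lτδ̄ + (Lτ+1)β̄²} < 1 − ν, inf_k f(x^k) > −∞, and ∇f(x^k_ex) ≠ 0 for all k. If the PLK condition holds for f at an accumulation point x̄ of (x^k), then the whole sequence (x^k) converges to x̄, and x̄ is a stationary point of f (∇f(x̄) = 0). -/
open Set Filter

/-- The Polyak–Łojasiewicz–Kurdyka (PLK) condition for `f` at `x₀`. -/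
def PLKCondition {n : ℕ} (f : EuclideanSpace ℝ (Fin n) → ℝ)
    (x₀ : EuclideanSpace ℝ (Fin n)) : Prop :=
  ∃ (η : ℝ) (U : Set (EuclideanSpace ℝ (Fin n))) (φ : ℝ → ℝ),
    0 < η ∧ U ∈ nhds x₀ ∧ φ 0 = 0 ∧
    (∀ t ∈ Set.Ico (0:ℝ) η, 0 ≤ φ t) ∧
    ConcaveOn ℝ (Set.Ico 0 η) φ ∧
    (∀ t ∈ Set.Ioo (0:ℝ) η, HasDerivAt φ (deriv φ t) t) ∧
    ContinuousOn (deriv φ) (Set.Ioo 0 η) ∧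
    (∀ t ∈ Set.Ioo (0:ℝ) η, 0 < deriv φ t) ∧
    ∀ x ∈ U, f x₀ < f x → f x < f x₀ + η →
      1 ≤ deriv φ (f x - f x₀) * ‖gradient f x‖

section Descent

variable {E : Type*} [NormedAddCommGroup E] [InnerProductSpace ℝ E] [CompleteSpace E]

/-- Two-sided quadratic bound for a function with Lipschitz gradient. -/
lemma abs_sub_sub_inner_gradient_le {f : E → ℝ} (hf : Differentiable ℝ f) {L : ℝ}
    (hlip : ∀ x y : E, ‖gradient f x - gradient f y‖ ≤ L * ‖x - y‖) (x v : E) :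
    |f (x + v) - f x - inner ℝ (gradient f x) v| ≤ L / 2 * ‖v‖ ^ 2 := by
  have hline : ∀ t : ℝ, HasDerivAt (fun t : ℝ => x + t • v) v t := fun t => by
    simpa using ((hasDerivAt_id t).smul_const v).const_add x
  have hderiv : ∀ t : ℝ, HasDerivAt
      (fun t : ℝ => f (x + t • v) - f x - t * inner ℝ (gradient f x) v)
      (inner ℝ (gradient f (x + t • v) - gradient f x) v) t := fun t => by
    have h := (hf (x + t • v)).hasGradientAt.hasFDerivAt.comp_hasDerivAt t (hline t)
    have h' := (h.sub_const (f x)).sub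
      ((hasDerivAt_id t).mul_const (inner ℝ (gradient f x) v))
    exact h'.congr_deriv (by simp [inner_sub_left])
  have hB : ∀ t : ℝ, HasDerivAt (fun t : ℝ => L / 2 * ‖v‖ ^ 2 * t ^ 2) (L * ‖v‖ ^ 2 * t) t :=
    fun t => ((hasDerivAt_pow 2 t).const_mul (L / 2 * ‖v‖ ^ 2)).congr_deriv (by
      simp only [Nat.cast_ofNat, Nat.add_one_sub_one, pow_one]
      ring)
  have key := image_norm_le_of_norm_deriv_right_le_deriv_boundary (a := 0) (b := 1)
    (fun t _ => (hderiv t).continuousAt.continuousWithinAt)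
    (fun t _ => (hderiv t).hasDerivWithinAt) (by simp) hB
    (fun t ht => by
      have h1 := hlip (x + t • v) x
      rw [add_sub_cancel_left, norm_smul, Real.norm_of_nonneg ht.1] at h1
      calc ‖inner ℝ (gradient f (x + t • v) - gradient f x) v‖
          ≤ ‖gradient f (x + t • v) - gradient f x‖ * ‖v‖ := norm_inner_le_norm _ _
        _ ≤ L * (t * ‖v‖) * ‖v‖ := by gcongr
        _ = L * ‖v‖ ^ 2 * t := by ring)
    (right_mem_Icc.2 zero_le_one)
  simpa using key

/-- Decrease of the objective along one inertial gradient step `d' = β d - τ g`, where `g`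
approximates the gradient at `x + γ d`. -/
lemma inertial_step_decrease {f : E → ℝ} (hf : Differentiable ℝ f) {L : ℝ} (hL : 0 ≤ L)
    (hlip : ∀ x y : E, ‖gradient f x - gradient f y‖ ≤ L * ‖x - y‖)
    {τ ν β γ δ : ℝ} (hτ : 0 ≤ τ) (hν : 0 ≤ ν) (hδ : |β - γ| ≤ δ) {x d g d' : E}
    (hd' : d' = β • d - τ • g)
    (hg : ‖g - gradient f (x + γ • d)‖ ≤ ν * ‖g‖) :
    2 * τ * (f (x + d') - f x) ≤ -(1 - L * τ - ν) * (τ * ‖g‖) ^ 2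
      - (1 - ν - L * τ * δ) * ‖d'‖ ^ 2 + ((1 + L * τ) * β ^ 2 + L * τ * δ) * ‖d‖ ^ 2 := by
  set z := x + β • d with hz
  have h1 := (abs_le.1 (abs_sub_sub_inner_gradient_le hf hlip z (-(τ • g)))).2
  have h2 := (abs_le.1 (abs_sub_sub_inner_gradient_le hf hlip z (-(β • d)))).1
  have e1 : z + -(τ • g) = x + d' := by rw [hz, hd']; abel
  have e2 : z + -(β • d) = x := by rw [hz]; abel
  rw [e1, norm_neg, norm_smul, Real.norm_of_nonneg hτ] at h1
  rw [e2, norm_neg, norm_smul, mul_pow, Real.norm_eq_abs, sq_abs] at h2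
  have e3 : inner ℝ (gradient f z) d'
      = inner ℝ (gradient f z) (-(τ • g)) - inner ℝ (gradient f z) (-(β • d)) := by
    rw [← inner_sub_right, hd']; congr 1; abel
  have hgz : ‖g - gradient f z‖ ≤ ν * ‖g‖ + L * (δ * ‖d‖) := by
    have h := hlip (x + γ • d) z
    have e : x + γ • d - z = -((β - γ) • d) := by rw [hz, sub_smul]; abel
    rw [e, norm_neg, norm_smul, Real.norm_eq_abs] at h
    calc ‖g - gradient f z‖
        ≤ ‖g - gradient f (x + γ • d)‖ + ‖gradient f (x + γ • d) - gradient f z‖ :=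
          norm_sub_le_norm_sub_add_norm_sub _ _ _
      _ ≤ ν * ‖g‖ + L * (|β - γ| * ‖d‖) := add_le_add hg h
      _ ≤ ν * ‖g‖ + L * (δ * ‖d‖) := by gcongr
  have h3 : inner ℝ (gradient f z) d' ≤ inner ℝ g d' + (ν * ‖g‖ + L * (δ * ‖d‖)) * ‖d'‖ := by
    have h := neg_le_of_abs_le (abs_real_inner_le_norm (g - gradient f z) d')
    have h' := mul_le_mul_of_nonneg_right hgz (norm_nonneg d')
    rw [inner_sub_left] at h
    linarith
  have h4 : 2 * τ * inner ℝ g d' = β ^ 2 * ‖d‖ ^ 2 - (τ * ‖g‖) ^ 2 - ‖d'‖ ^ 2 := by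
    have e : β • d = d' + τ • g := by rw [hd']; abel
    have h := congrArg (fun w => ‖w‖ ^ 2) e
    simp only [norm_add_sq_real, norm_smul, mul_pow, Real.norm_eq_abs, sq_abs,
      inner_smul_right] at h
    rw [real_inner_comm]
    linarith
  have hδ0 : 0 ≤ δ := (abs_nonneg _).trans hδ
  have h5 : 0 ≤ ν * (τ * ‖g‖ - ‖d'‖) ^ 2 := by positivity
  have h6 : 0 ≤ L * τ * δ * (‖d‖ - ‖d'‖) ^ 2 := by positivity
  have h7 : f (x + d') - f x ≤ inner ℝ g d' + (ν * ‖g‖ + L * (δ * ‖d‖)) * ‖d'‖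
      + L / 2 * (τ * ‖g‖) ^ 2 + L / 2 * (β ^ 2 * ‖d‖ ^ 2) := by linarith
  have h8 := mul_le_mul_of_nonneg_left h7 (by positivity : 0 ≤ 2 * τ)
  linarith

end Descent

/-- A sequence whose steps near a cluster point are controlled by the decrease of a bounded
below quantity converges to that cluster point. -/
lemma tendsto_of_mapClusterPt_of_dist_le_sub {X : Type*} [PseudoMetricSpace X] {y : ℕ → X}
    {a : X} (ha : MapClusterPt a atTop y) {Φ : ℕ → ℝ} {ρ : ℝ} (hρ : 0 < ρ) {N : ℕ}
    (hΦ0 : ∀ k ≥ N, 0 ≤ Φ k) (hΦ : ∀ k ≥ N, Φ (k + 1) ≤ Φ k)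
    (hstep : ∀ k ≥ N, dist (y k) a < ρ → dist (y k) (y (k + 1)) ≤ Φ k - Φ (k + 1)) :
    Tendsto y atTop (nhds a) := by
  have hanti : Antitone fun k => Φ (N + k) := antitone_nat_of_succ_le fun k =>
    hΦ _ (Nat.le_add_right N k)
  have hbdd : BddBelow (range fun k => Φ (N + k)) :=
    ⟨0, by rintro _ ⟨k, rfl⟩; exact hΦ0 _ (Nat.le_add_right N k)⟩
  obtain ⟨l, hl⟩ : ∃ l, l = ⨅ k, Φ (N + k) := ⟨_, rfl⟩
  have hlim := tendsto_atTop_ciInf hanti hbdd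
  rw [← hl] at hlim
  have hle : ∀ k ≥ N, l ≤ Φ k := fun k hk => by
    obtain ⟨j, rfl⟩ := Nat.exists_eq_add_of_le hk
    exact hl ▸ ciInf_le hbdd j
  rw [Metric.tendsto_atTop]
  intro ε hε
  have hε' : 0 < min ε ρ / 2 := by positivity
  obtain ⟨M, hM⟩ := eventually_atTop.1 (hlim.eventually_lt_const (lt_add_of_pos_right l hε'))
  obtain ⟨K, hKM, hK⟩ := (mapClusterPt_iff_frequently.1 ha _
    (Metric.ball_mem_nhds a hε')).forall_exists_of_atTop (N + M)
  have hΦK : Φ K < l + min ε ρ / 2 := by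
    obtain ⟨j, rfl⟩ := Nat.exists_eq_add_of_le hKM
    have := hM (M + j) (by omega)
    rwa [← add_assoc] at this
  have hnear : ∀ j, dist (y K) (y (K + j)) ≤ Φ K - Φ (K + j) → dist (y (K + j)) a < min ε ρ := by
    intro j hj
    have h1 := dist_triangle_left (y (K + j)) a (y K)
    have h2 := hle (K + j) (by omega)
    have h3 := Metric.mem_ball.1 hK
    linarith
  have hsum : ∀ j, dist (y K) (y (K + j)) ≤ Φ K - Φ (K + j) := by
    intro j
    induction j with
    | zero => simp
    | succ j ih =>
      have h1 := hstep (K + j) (by omega) ((hnear j ih).trans_le (min_le_right _ _))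
      have h2 := dist_triangle (y K) (y (K + j)) (y (K + j + 1))
      rw [← add_assoc]
      linarith
  refine ⟨K, fun k hk => ?_⟩
  obtain ⟨j, rfl⟩ := Nat.exists_eq_add_of_le hk
  exact (hnear j (hsum j)).trans_le (min_le_left _ _)

/-- Step length estimate for an energy `e = s + q`, where `s` is desingularized by `φ` and
`q` is quadratically bounded by the step length `r`: the function
`t ↦ 2 φ (t / 2) + √t` desingularizes the energy. -/
lemma step_le_desingularized_sub {φ : ℝ → ℝ} {η : ℝ} (hφ : ConcaveOn ℝ (Set.Ico 0 η) φ)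
    (hφd : ∀ t ∈ Set.Ioo (0 : ℝ) η, HasDerivAt φ (deriv φ t) t)
    (hφpos : ∀ t ∈ Set.Ioo (0 : ℝ) η, 0 < deriv φ t)
    {e e' s q r G a c C : ℝ} (he' : 0 < e') (hee' : e' < e) (heη : e < η) (hes : e = s + q)
    (hq0 : 0 ≤ q) (hq : q ≤ c * r ^ 2) (ha : 0 ≤ a) (har : a * r ^ 2 ≤ e - e') (hr : 0 < r)
    (hC : 0 ≤ C) (hG : G ≤ C * r) (hs : 0 < s → 1 ≤ deriv φ s * G) :
    a * r ≤ (C + 2 * √(2 * c)) *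
      ((2 * φ (e / 2) + √e) - (2 * φ (e' / 2) + √e')) := by
  have he : 0 < e := he'.trans hee'
  have hmem : e / 2 ∈ Set.Ioo 0 η := ⟨by linarith, by linarith⟩
  have hA := hφpos _ hmem
  have hslope := hφ.le_slope_of_hasDerivAt (x := e' / 2) ⟨by linarith, by linarith⟩
    (Ioo_subset_Ico_self hmem) (by linarith) (hφd _ hmem)
  rw [slope_def_field, le_div_iff₀ (by linarith)] at hslope
  have hφle : deriv φ (e / 2) * (e - e') ≤ 2 * φ (e / 2) - 2 * φ (e' / 2) := by linarith
  have hφ0 : 0 ≤ 2 * φ (e / 2) - 2 * φ (e' / 2) :=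
    (mul_nonneg hA.le (by linarith)).trans hφle
  have hsq0 : 0 ≤ √e - √e' := sub_nonneg.2 (Real.sqrt_le_sqrt hee'.le)
  have hc0 := Real.sqrt_nonneg (2 * c)
  rcases le_or_gt (e / 2) s with h | h
  · have hs0 : 0 < s := by linarith
    have hds : deriv φ s ≤ deriv φ (e / 2) := by
      rcases h.eq_or_lt with h | h
      · rw [h]
      · have hsm : s ∈ Set.Ioo 0 η := ⟨hs0, by linarith⟩
        exact (hφ.le_slope_of_hasDerivAt (Ioo_subset_Ico_self hmem) (Ioo_subset_Ico_self hsm) h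
          (hφd _ hsm)).trans (hφ.slope_le_of_hasDerivAt (Ioo_subset_Ico_self hmem)
          (Ioo_subset_Ico_self hsm) h (hφd _ hmem))
    have h1 : 1 ≤ deriv φ (e / 2) * (C * r) := by
      have hds0 := hφpos s ⟨hs0, by linarith⟩
      have hCr : 0 ≤ C * r := by positivity
      calc 1 ≤ deriv φ s * G := hs hs0
        _ ≤ deriv φ s * (C * r) := by gcongr
        _ ≤ deriv φ (e / 2) * (C * r) := by gcongr
    calc a * r = 1 * (a * r) := (one_mul _).symm
      _ ≤ deriv φ (e / 2) * (C * r) * (a * r) := by gcongr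
      _ = C * (deriv φ (e / 2) * (a * r ^ 2)) := by ring
      _ ≤ C * (deriv φ (e / 2) * (e - e')) := by gcongr
      _ ≤ C * ((2 * φ (e / 2) + √e) - (2 * φ (e' / 2) + √e')) := by gcongr; linarith
      _ ≤ _ := mul_le_mul_of_nonneg_right (by linarith) (by linarith)
  · have h1 : √e ≤ √(2 * c) * r := by
      rw [← Real.sqrt_sq hr.le, ← Real.sqrt_mul' _ (sq_nonneg r)]
      exact Real.sqrt_le_sqrt (by linarith)
    have h2 : e - e' ≤ 2 * (√e * (√e - √e')) := by
      nlinarith [Real.sq_sqrt he.le, Real.sq_sqrt he'.le]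
    have h3 : a * r * r ≤ 2 * √(2 * c) * (√e - √e') * r := by
      have := mul_le_mul_of_nonneg_right h1 hsq0
      linarith
    calc a * r ≤ 2 * √(2 * c) * (√e - √e') := le_of_mul_le_mul_right h3 hr
      _ ≤ 2 * √(2 * c) * ((2 * φ (e / 2) + √e) - (2 * φ (e' / 2) + √e')) :=
        mul_le_mul_of_nonneg_left (by linarith) (by linarith)
      _ ≤ _ := mul_le_mul_of_nonneg_right (by linarith) (by linarith)

/-- Convergence under the PLK condition of a sequence along which an energy `f + q` decreases
quadratically in a quantity `r` that dominates the gradient, the steps and `√q`. -/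
lemma PLKCondition.tendsto_of_energy_decrease {n : ℕ} {f : EuclideanSpace ℝ (Fin n) → ℝ}
    (hf : Continuous f) (hgrad : Continuous (gradient f))
    {y : ℕ → EuclideanSpace ℝ (Fin n)} {q r : ℕ → ℝ} {a b c C m : ℝ}
    (ha : 0 < a) (hb : 0 ≤ b) (hC : 0 ≤ C) (hr : ∀ k, 0 < r k) (hq0 : ∀ k, 0 ≤ q k)
    (hq : ∀ k, q k ≤ c * r k ^ 2)
    (hdec : ∀ k, a * r k ^ 2 ≤ (f (y k) + q k) - (f (y (k + 1)) + q (k + 1)))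
    (hstep : ∀ k, dist (y k) (y (k + 1)) ≤ b * r k)
    (hgr : ∀ k, ‖gradient f (y k)‖ ≤ C * r k) (hm : ∀ k, m ≤ f (y k))
    {z : EuclideanSpace ℝ (Fin n)} (hz : MapClusterPt z atTop y) (hPLK : PLKCondition f z) :
    Tendsto y atTop (nhds z) ∧ gradient f z = 0 := by
  set e : ℕ → ℝ := fun k => f (y k) + q k with he_def
  have hlt : ∀ k, e (k + 1) < e k := fun k => by
    have := mul_pos ha (pow_pos (hr k) 2)
    have := hdec k
    simp only [he_def]
    linarith
  have hanti : StrictAnti e := strictAnti_nat_of_succ_lt hlt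
  have hbdd : BddBelow (range e) := ⟨m, by
    rintro _ ⟨k, rfl⟩; exact (hm k).trans (le_add_of_nonneg_right (hq0 k))⟩
  obtain ⟨l, hl⟩ : ∃ l, Tendsto e atTop (nhds l) := ⟨_, tendsto_atTop_ciInf hanti.antitone hbdd⟩
  have hr2 : Tendsto (fun k => r k ^ 2) atTop (nhds 0) := by
    have h := (hl.sub ((tendsto_add_atTop_iff_nat 1).2 hl)).div_const a
    rw [sub_self, zero_div] at h
    refine squeeze_zero (fun k => sq_nonneg _) (fun k => ?_) h
    rw [le_div_iff₀ ha, mul_comm]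
    exact hdec k
  have hr0 : Tendsto r atTop (nhds 0) := by
    have h := (Real.continuous_sqrt.tendsto 0).comp hr2
    rw [Real.sqrt_zero] at h
    exact h.congr fun k => Real.sqrt_sq (hr k).le
  have hqlim : Tendsto q atTop (nhds 0) :=
    squeeze_zero hq0 hq (by simpa using hr2.const_mul c)
  have hflim : Tendsto (fun k => f (y k)) atTop (nhds l) := by
    simpa [he_def] using hl.sub hqlim
  have hglim : Tendsto (fun k => gradient f (y k)) atTop (nhds 0) :=
    squeeze_zero_norm hgr (by simpa using hr0.const_mul C)
  obtain ⟨ψ, hψ, hψz⟩ := hz.tendsto_subseq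
  have hlz : f z = l := tendsto_nhds_unique ((hf.tendsto z).comp hψz)
    (hflim.comp hψ.tendsto_atTop)
  refine ⟨?_, tendsto_nhds_unique ((hgrad.tendsto z).comp hψz) (hglim.comp hψ.tendsto_atTop)⟩
  obtain ⟨η, U, φ, hη, hU, -, hφ0, hφ, hφd, -, hφpos, hPL⟩ := hPLK
  obtain ⟨ρ, hρ, hρU⟩ := Metric.mem_nhds_iff.1 hU
  have hlow : ∀ k, f z < e k := fun k => by
    rw [hlz]
    exact (hanti.antitone.le_of_tendsto hl (k + 1)).trans_lt (hlt k)
  obtain ⟨N, hN⟩ := eventually_atTop.1 (hl.eventually_lt_const (lt_add_of_pos_right l hη))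
  have hest : ∀ k ≥ N, ∀ hk : dist (y k) z < ρ, a * r k ≤ (C + 2 * √(2 * c)) *
      ((2 * φ ((e k - f z) / 2) + √(e k - f z))
        - (2 * φ ((e (k + 1) - f z) / 2) + √(e (k + 1) - f z))) := by
    intro k hk hky
    have hekN := hN k hk
    refine step_le_desingularized_sub hφ hφd hφpos (s := f (y k) - f z) (q := q k)
      (G := ‖gradient f (y k)‖) (sub_pos.2 (hlow _)) (sub_lt_sub_right (hlt k) _)
      (by linarith) (by simp only [he_def]; ring) (hq0 k) (hq k) ha.le
      ((hdec k).trans_eq (by simp only [he_def]; ring)) (hr k) hC (hgr k) fun hs => ?_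
    refine hPL _ (hρU hky) (sub_pos.1 hs) ?_
    have := hq0 k
    simp only [he_def] at hekN
    linarith
  have hφmono : ∀ s t, 0 < s → s < t → t < η → φ s ≤ φ t := fun s t hs hst ht => by
    have htm : t ∈ Set.Ioo 0 η := ⟨hs.trans hst, ht⟩
    have h := hφ.le_slope_of_hasDerivAt (x := s) ⟨hs.le, hst.trans ht⟩
      (Ioo_subset_Ico_self htm) hst (hφd t htm)
    rw [slope_def_field, le_div_iff₀ (sub_pos.2 hst)] at h
    have := mul_pos (hφpos t htm) (sub_pos.2 hst)
    linarith
  have hM : 0 ≤ C + 2 * √(2 * c) := by positivity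
  refine tendsto_of_mapClusterPt_of_dist_le_sub hz hρ (N := N)
    (Φ := fun k => b / a * ((C + 2 * √(2 * c)) *
      (2 * φ ((e k - f z) / 2) + √(e k - f z)))) ?_ ?_ ?_
  · intro k hk
    have := hφ0 ((e k - f z) / 2) ⟨by linarith [hlow k], by linarith [hlow k, hN k hk]⟩
    positivity
  · intro k hk
    have h1 := hlow (k + 1)
    have h2 := hlt k
    have := hN k hk
    gcongr
    exact hφmono _ _ (by linarith) (by linarith) (by linarith)
  · intro k hk hky
    calc dist (y k) (y (k + 1)) ≤ b * r k := hstep k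
      _ = b / a * (a * r k) := by field_simp
      _ ≤ _ := mul_le_mul_of_nonneg_left (hest k hk hky) (by positivity)
      _ = _ := by ring

/-- Global IGDm under the PLK condition: if the PLK condition holds for `f` at an
accumulation point `xb` of the IGDm iterates, then the whole sequence converges to `xb`,
which is a stationary point of `f`. -/
theorem IGDm_global_convergence_PLK {n : ℕ}
    (f : EuclideanSpace ℝ (Fin n) → ℝ)
    (hdiff : Differentiable ℝ f)
    (L : ℝ) (hL : 0 < L)
    (hlip : ∀ x y : EuclideanSpace ℝ (Fin n),
      ‖gradient f x - gradient f y‖ ≤ L * ‖x - y‖)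
    (τ ν βbar δbar : ℝ) (hτ : 0 < τ) (hν : ν ∈ Set.Ioo (0:ℝ) 1)
    (β γ : ℕ → ℝ) (hβnn : ∀ k, 0 ≤ β k) (hγnn : ∀ k, 0 ≤ γ k)
    (hβbar : ∀ k, β k ≤ βbar) (hβbar1 : βbar < 1)
    (hδbar : ∀ k, |β k - γ k| ≤ δbar)
    (x xin xex g : ℕ → EuclideanSpace ℝ (Fin n))
    (hx01 : x 0 = x 1)
    (hxin : ∀ k, 1 ≤ k → xin k = x k + β k • (x k - x (k-1)))
    (hxex : ∀ k, 1 ≤ k → xex k = x k + γ k • (x k - x (k-1)))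
    (hupd : ∀ k, 1 ≤ k → x (k+1) = xin k - τ • g k)
    (hg : ∀ k, 1 ≤ k → ‖g k - gradient f (xex k)‖ ≤ ν * ‖g k‖)
    (hparam : max (L*τ) (2*L*τ*δbar + (L*τ+1)*βbar^2) < 1 - ν)
    (hbdd : ∃ m : ℝ, ∀ k, m ≤ f (x k))
    (hne : ∀ k, 1 ≤ k → gradient f (xex k) ≠ 0)
    (xb : EuclideanSpace ℝ (Fin n))
    (hacc : MapClusterPt xb atTop x)
    (hPLK : PLKCondition f xb) :
    Tendsto x atTop (nhds xb) ∧ gradient f xb = 0 := by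
  obtain ⟨hparam1, hparam2⟩ := max_lt_iff.1 hparam
  obtain ⟨m, hm⟩ := hbdd
  have hgrad : Continuous (gradient f) :=
    (LipschitzWith.of_dist_le_mul (K := ⟨L, hL.le⟩) fun x y => by
      rw [dist_eq_norm, dist_eq_norm]
      exact hlip x y).continuous
  have hδ0 : 0 ≤ δbar := (abs_nonneg _).trans (hδbar 0)
  have hβ0 : 0 ≤ βbar := (hβnn 0).trans (hβbar 0)
  have hν0 := hν.1
  obtain ⟨P, hP⟩ : ∃ P, P = 1 - ν - L * τ * δbar := ⟨_, rfl⟩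
  obtain ⟨Q, hQ⟩ : ∃ Q, Q = (1 + L * τ) * βbar ^ 2 + L * τ * δbar := ⟨_, rfl⟩
  have hQ0 : 0 ≤ Q := by rw [hQ]; positivity
  have hQP : Q < P := by rw [hP, hQ]; linarith
  obtain ⟨c, hc⟩ : ∃ c, c = (P + Q) / (4 * τ) := ⟨_, rfl⟩
  have hc0 : 0 ≤ c := by rw [hc]; have := hQ0.trans hQP.le; positivity
  have hcτ : 2 * τ * c = (P + Q) / 2 := by rw [hc]; field_simp; ring
  obtain ⟨κ, hκ⟩ : ∃ κ, κ = min ((1 - L * τ - ν) * τ ^ 2) ((P - Q) / 2) := ⟨_, rfl⟩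
  have hκ0 : 0 < κ := by
    rw [hκ]
    refine lt_min (mul_pos (by linarith) (by positivity)) (by linarith)
  have hκ1 : κ ≤ (1 - L * τ - ν) * τ ^ 2 := hκ ▸ min_le_left _ _
  have hκ2 : κ ≤ (P - Q) / 2 := hκ ▸ min_le_right _ _
  have hd' : ∀ k, x (k + 2) - x (k + 1)
      = β (k + 1) • (x (k + 1) - x k) - τ • g (k + 1) := fun k => by
    rw [hupd (k + 1) (by omega), hxin (k + 1) (by omega), Nat.add_sub_cancel]
    abel
  have hxex' : ∀ k, xex (k + 1) = x (k + 1) + γ (k + 1) • (x (k + 1) - x k) := fun k =>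
    hxex (k + 1) (by omega)
  have hg' : ∀ k, ‖g (k + 1) - gradient f (xex (k + 1))‖ ≤ ν * ‖g (k + 1)‖ := fun k =>
    hg (k + 1) (by omega)
  have hgpos : ∀ k, 0 < ‖g (k + 1)‖ := fun k => by
    refine norm_pos_iff.2 fun h0 => hne (k + 1) (by omega) ?_
    simpa [h0] using hg' k
  have hdecrease : ∀ k, κ / (4 * τ) * (‖g (k + 1)‖ + ‖x (k + 1) - x k‖) ^ 2 ≤
      (f (x (k + 1)) + c * ‖x (k + 1) - x k‖ ^ 2)
        - (f (x (k + 2)) + c * ‖x (k + 2) - x (k + 1)‖ ^ 2) := by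
    intro k
    have h := inertial_step_decrease hdiff hL.le hlip hτ.le hν0.le (hδbar (k + 1)) (hd' k)
      (hxex' k ▸ hg' k)
    rw [add_sub_cancel, ← hP] at h
    have hβsq : β (k + 1) ^ 2 ≤ βbar ^ 2 := pow_le_pow_left₀ (hβnn _) (hβbar _) 2
    have hQk : ((1 + L * τ) * β (k + 1) ^ 2 + L * τ * δbar) * ‖x (k + 1) - x k‖ ^ 2
        ≤ Q * ‖x (k + 1) - x k‖ ^ 2 := by
      rw [hQ]
      gcongr
    have h1 := mul_le_mul_of_nonneg_right hκ1 (sq_nonneg ‖g (k + 1)‖)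
    have h2 := mul_le_mul_of_nonneg_right hκ2 (sq_nonneg ‖x (k + 1) - x k‖)
    have h3 : 0 ≤ (P - Q) / 2 * ‖x (k + 2) - x (k + 1)‖ ^ 2 :=
      mul_nonneg (by linarith) (sq_nonneg _)
    have h4 := mul_nonneg hκ0.le (sq_nonneg (‖g (k + 1)‖ - ‖x (k + 1) - x k‖))
    rw [div_mul_eq_mul_div, div_le_iff₀ (by positivity)]
    linear_combination 2 * h + 2 * hQk + 2 * h1 + 2 * h2 + 2 * h3 + h4
      + 2 * (‖x (k + 2) - x (k + 1)‖ ^ 2 - ‖x (k + 1) - x k‖ ^ 2) * hcτ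
  have hstep : ∀ k, dist (x (k + 1)) (x (k + 2))
      ≤ (βbar + τ) * (‖g (k + 1)‖ + ‖x (k + 1) - x k‖) := by
    intro k
    rw [dist_comm, dist_eq_norm, hd']
    calc ‖β (k + 1) • (x (k + 1) - x k) - τ • g (k + 1)‖
        ≤ β (k + 1) * ‖x (k + 1) - x k‖ + τ * ‖g (k + 1)‖ := by
          refine (norm_sub_le _ _).trans_eq ?_
          rw [norm_smul, norm_smul, Real.norm_of_nonneg (hβnn _), Real.norm_of_nonneg hτ.le]
      _ ≤ βbar * ‖x (k + 1) - x k‖ + τ * ‖g (k + 1)‖ := by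
          gcongr
          exact hβbar _
      _ ≤ _ := by
          have := mul_nonneg hβ0 (norm_nonneg (g (k + 1)))
          have := mul_nonneg hτ.le (norm_nonneg (x (k + 1) - x k))
          linarith
  have hgr : ∀ k, ‖gradient f (x (k + 1))‖
      ≤ (1 + ν + L * (βbar + δbar)) * (‖g (k + 1)‖ + ‖x (k + 1) - x k‖) := by
    intro k
    have hγ : γ (k + 1) ≤ βbar + δbar := by
      linarith [hβbar (k + 1), neg_le_of_abs_le (hδbar (k + 1))]
    have h1 := hlip (x (k + 1)) (xex (k + 1))
    rw [hxex' k, sub_add_cancel_left, norm_neg, norm_smul, Real.norm_of_nonneg (hγnn _),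
      ← hxex' k] at h1
    have h2 : L * (γ (k + 1) * ‖x (k + 1) - x k‖)
        ≤ L * ((βbar + δbar) * ‖x (k + 1) - x k‖) := by gcongr
    have h3 := norm_le_norm_add_norm_sub' (gradient f (x (k + 1))) (gradient f (xex (k + 1)))
    have h4 := norm_le_norm_add_norm_sub (g (k + 1)) (gradient f (xex (k + 1)))
    have h5 := hg' k
    have h6 : 0 ≤ L * (βbar + δbar) * ‖g (k + 1)‖ := by positivity
    have h7 : 0 ≤ (1 + ν) * ‖x (k + 1) - x k‖ := by positivity
    linarith
  have hacc' : MapClusterPt xb atTop fun k => x (k + 1) := by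
    rw [MapClusterPt, ← map_add_atTop_eq_nat 1, Filter.map_map] at hacc
    exact hacc
  obtain ⟨hlim, hstat⟩ := PLKCondition.tendsto_of_energy_decrease hdiff.continuous hgrad
    (y := fun k => x (k + 1)) (q := fun k => c * ‖x (k + 1) - x k‖ ^ 2)
    (r := fun k => ‖g (k + 1)‖ + ‖x (k + 1) - x k‖) (a := κ / (4 * τ)) (b := βbar + τ)
    (c := c) (C := 1 + ν + L * (βbar + δbar)) (by positivity) (by positivity) (by positivity)
    (fun k => add_pos_of_pos_of_nonneg (hgpos k) (norm_nonneg _)) (fun k => by positivity)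
    (fun k => by
      gcongr
      exact le_add_of_nonneg_left (norm_nonneg _))
    hdecrease hstep hgr (fun k => hm (k + 1)) hacc' hPLK
  exact ⟨(tendsto_add_atTop_iff_nat 1).1 hlim, hstat⟩
end

section
/- Let f : ℝⁿ → ℝ be C¹ with L-Lipschitz gradient on all of ℝⁿ, and let (x^k) be IGDm iterates with X = ℝⁿ, parameters satisfying max{Lτ, 2Lτδ̄ + (Lτ+1)β̄²} < 1 − ν, inf_k f(x^k) > −∞, and ∇f(x^k_ex) ≠ 0 for all k. Assume f satisfies the exponential PLK condition at an accumulation point x̄ of (x^k) with exponent q ∈ [0,1) and constant M > 0. Then x^k → x̄ and: (i) if q ∈ [0,1/2], the sequences (x^k), (∇f(x^k)), (f(x^k)) converge linearly to x̄, 0, f(x̄), respectively; (ii) if q ∈ (1/2,1), there exists C > 0 such that for all large k, ‖x^k − x̄‖ ≤ C·k^{−(1−q)/(2q−1)}, ‖∇f(x^k)‖ ≤ C·k^{−(1−q)/(2q−1)}, and f(x^k) − f(x̄) ≤ C·k^{−(2−2q)/(2q−1)}. -/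
open Set Filter

/-- The exponential PLK condition for `f` at `x₀` with exponent `q` and constant `M`:
`M(1-q)(f x - f x₀)^(-q) ‖∇f x‖ ≥ 1` for `x` near `x₀` with `f x₀ < f x < f x₀ + η`. -/
def ExpPLKCondition {n : ℕ} (f : EuclideanSpace ℝ (Fin n) → ℝ)
    (x₀ : EuclideanSpace ℝ (Fin n)) (M q : ℝ) : Prop :=
  ∃ (η : ℝ) (U : Set (EuclideanSpace ℝ (Fin n))),
    0 < η ∧ U ∈ nhds x₀ ∧
    ∀ x ∈ U, f x₀ < f x → f x < f x₀ + η →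
      1 ≤ M * (1 - q) * (f x - f x₀) ^ (-q : ℝ) * ‖gradient f x‖


/-- One side of the descent lemma: the quadratic upper bound for a function with Lipschitz gradient. -/
theorem HasGradientAt.le_add_inner_add_sq {E : Type*} [NormedAddCommGroup E]
    [InnerProductSpace ℝ E] [CompleteSpace E] {f : E → ℝ} {G : E → E} {L : ℝ}
    (hf : ∀ x, HasGradientAt f (G x) x) (hG : ∀ x y, ‖G x - G y‖ ≤ L * ‖x - y‖) (y z : E) :
    f y ≤ f z + inner ℝ (G z) (y - z) + L / 2 * ‖y - z‖ ^ 2 := by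
  set v := y - z with hv
  let ψ : ℝ → ℝ := fun t => f (z + t • v) - t * inner ℝ (G z) v - L / 2 * t ^ 2 * ‖v‖ ^ 2
  have hψ : ∀ t, HasDerivAt ψ (inner ℝ (G (z + t • v)) v - inner ℝ (G z) v
      - L * t * ‖v‖ ^ 2) t := by
    intro t
    have h1 : HasDerivAt (fun t : ℝ => z + t • v) v t := by
      simpa using ((hasDerivAt_id t).smul_const v).const_add z
    have h2 : HasDerivAt (fun t : ℝ => f (z + t • v)) (inner ℝ (G (z + t • v)) v) t := by
      have := (hf (z + t • v)).hasFDerivAt.comp_hasDerivAt t h1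
      rwa [InnerProductSpace.toDual_apply_apply] at this
    have h3 : HasDerivAt (fun t : ℝ => t * inner ℝ (G z) v) (inner ℝ (G z) v) t := by
      simpa using (hasDerivAt_id t).mul_const (inner ℝ (G z) v)
    have h4 : HasDerivAt (fun t : ℝ => L / 2 * t ^ 2 * ‖v‖ ^ 2) (L * t * ‖v‖ ^ 2) t := by
      refine (((hasDerivAt_pow 2 t).const_mul (L / 2)).mul_const (‖v‖ ^ 2)).congr_deriv ?_
      push_cast
      ring
    exact (h2.sub h3).sub h4
  have hanti : AntitoneOn ψ (Icc 0 1) := by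
    refine antitoneOn_of_deriv_nonpos (convex_Icc 0 1)
      (fun t _ => (hψ t).continuousAt.continuousWithinAt)
      (fun t _ => (hψ t).differentiableAt.differentiableWithinAt) ?_
    intro t ht
    rw [interior_Icc] at ht
    rw [(hψ t).deriv, ← inner_sub_left]
    have h1 := real_inner_le_norm (G (z + t • v) - G z) v
    have h2 : ‖G (z + t • v) - G z‖ ≤ L * (t * ‖v‖) := by
      simpa [norm_smul, abs_of_pos ht.1] using hG (z + t • v) z
    nlinarith [mul_le_mul_of_nonneg_right h2 (norm_nonneg v)]
  have := hanti (left_mem_Icc.2 zero_le_one) (right_mem_Icc.2 zero_le_one) zero_le_one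
  have hy : z + v = y := by simp [hv]
  simp only [ψ, one_smul, zero_smul, hy, add_zero] at this
  linarith

/-- The descent lemma, in two-sided form. -/
theorem HasGradientAt.abs_sub_sub_inner_le {E : Type*} [NormedAddCommGroup E]
    [InnerProductSpace ℝ E] [CompleteSpace E] {f : E → ℝ} {G : E → E} {L : ℝ}
    (hf : ∀ x, HasGradientAt f (G x) x) (hG : ∀ x y, ‖G x - G y‖ ≤ L * ‖x - y‖) (y z : E) :
    |f y - f z - inner ℝ (G z) (y - z)| ≤ L / 2 * ‖y - z‖ ^ 2 := by
  have h1 := HasGradientAt.le_add_inner_add_sq hf hG y z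
  have hneg : ∀ x, HasGradientAt (fun x => - f x) (- G x) x := by
    intro x
    rw [hasGradientAt_iff_hasFDerivAt, map_neg]
    exact (hf x).hasFDerivAt.neg
  have h2 := HasGradientAt.le_add_inner_add_sq hneg (L := L)
    (fun x y => by rw [← neg_sub', norm_neg]; exact hG x y) y z
  rw [inner_neg_left] at h2
  rw [abs_le]
  constructor <;> linarith

/-- A Lyapunov inequality for one inertial gradient step `u' = u + a - τ g`, where `a = b • d`. -/
theorem inertial_step_decrease_s11 {E : Type*} [NormedAddCommGroup E]
    [InnerProductSpace ℝ E] [CompleteSpace E] {f : E → ℝ} {G : E → E} {L τ ν b c βbar δbar : ℝ}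
    (hf : ∀ x, HasGradientAt f (G x) x) (hG : ∀ x y, ‖G x - G y‖ ≤ L * ‖x - y‖)
    (hL : 0 < L) (hτ : 0 < τ) (hν : 0 ≤ ν) (hb : 0 ≤ b) (hbb : b ≤ βbar) (hbc : |b - c| ≤ δbar)
    {u d g u' : E} (hu' : u' = u + b • d - τ • g)
    (hg : ‖g - G (u + c • d)‖ ≤ ν * ‖g‖) :
    2 * τ * f u' + (1 - ν - L * τ * δbar) * ‖u' - u‖ ^ 2 + (1 - ν - L * τ) * τ ^ 2 * ‖g‖ ^ 2
      ≤ 2 * τ * f u + (L * τ * δbar + (L * τ + 1) * βbar ^ 2) * ‖d‖ ^ 2 := by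
  set z := u + b • d with hz
  set e := G z - g with he
  have hG1 := (abs_le.1 (HasGradientAt.abs_sub_sub_inner_le hf hG u' z)).2
  have hG2 := (abs_le.1 (HasGradientAt.abs_sub_sub_inner_le hf hG u z)).1
  have e1 : u' - z = -(τ • g) := by rw [hu']; abel
  have e2 : u - z = -(b • d) := by rw [hz]; abel
  have n1 : ‖u' - z‖ ^ 2 = τ ^ 2 * ‖g‖ ^ 2 := by
    rw [e1, norm_neg, norm_smul, mul_pow, Real.norm_eq_abs, sq_abs]
  have n2 : ‖u - z‖ ^ 2 = b ^ 2 * ‖d‖ ^ 2 := by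
    rw [e2, norm_neg, norm_smul, mul_pow, Real.norm_eq_abs, sq_abs]
  have hin : inner ℝ (G z) (u' - z) - inner ℝ (G z) (u - z) =
      inner ℝ g (u' - u) + inner ℝ e (u' - u) := by
    rw [← inner_sub_right, ← inner_add_left, he]
    congr 1 <;> abel
  have hgu : 2 * (τ * inner ℝ g (u' - u)) = b ^ 2 * ‖d‖ ^ 2 - ‖u' - u‖ ^ 2 - τ ^ 2 * ‖g‖ ^ 2 := by
    have h1 : b • d = (u' - u) + τ • g := by rw [hu', hz]; abel
    have h2 : ‖b • d‖ ^ 2 = b ^ 2 * ‖d‖ ^ 2 := by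
      rw [norm_smul, mul_pow, Real.norm_eq_abs, sq_abs]
    rw [← h2, h1, norm_add_sq_real, norm_smul, mul_pow, Real.norm_eq_abs, sq_abs,
      inner_smul_right, real_inner_comm]
    ring
  have hen : ‖e‖ ≤ ν * ‖g‖ + L * δbar * ‖d‖ := by
    have h1 : e = (G z - G (u + c • d)) - (g - G (u + c • d)) := by rw [he]; abel
    have h2 : ‖G z - G (u + c • d)‖ ≤ L * (|b - c| * ‖d‖) := by
      have := hG z (u + c • d)
      rwa [hz, add_sub_add_left_eq_sub, ← sub_smul, norm_smul, Real.norm_eq_abs] at this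
    have h3 : L * (|b - c| * ‖d‖) ≤ L * (δbar * ‖d‖) := by gcongr
    have h4 := norm_sub_le (G z - G (u + c • d)) (g - G (u + c • d))
    rw [← h1] at h4
    linarith
  have hes : inner ℝ e (u' - u) ≤ (ν * ‖g‖ + L * δbar * ‖d‖) * ‖u' - u‖ :=
    (real_inner_le_norm _ _).trans (by gcongr)
  have hδ : 0 ≤ δbar := (abs_nonneg _).trans hbc
  have hβ2 : b ^ 2 ≤ βbar ^ 2 := by gcongr
  have a1 := mul_nonneg hν (sq_nonneg (τ * ‖g‖ - ‖u' - u‖))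
  have a2 := mul_nonneg (mul_nonneg (mul_nonneg hL.le hτ.le) hδ) (sq_nonneg (‖d‖ - ‖u' - u‖))
  have a3 := mul_le_mul_of_nonneg_left
    (mul_le_mul_of_nonneg_right hβ2 (sq_nonneg ‖d‖)) (by positivity : 0 ≤ L * τ + 1)
  have a4 := mul_le_mul_of_nonneg_left hes hτ.le
  rw [n1] at hG1
  rw [n2] at hG2
  have hmain : f u' - f u ≤ inner ℝ g (u' - u) + inner ℝ e (u' - u)
      + L / 2 * (τ ^ 2 * ‖g‖ ^ 2) + L / 2 * (b ^ 2 * ‖d‖ ^ 2) := by linarith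
  have a5 := mul_le_mul_of_nonneg_left hmain hτ.le
  nlinarith

/-- The exponent of the PLK condition can be raised to `max q (1/2)`, division-free form. -/
theorem rpow_max_half_le {t B q : ℝ} (ht : 0 < t) (ht1 : t ≤ 1)
    (h : 1 ≤ B * t ^ (-q)) : t ^ (max q (1 / 2)) ≤ B := by
  have h1 : t ^ (max q (1 / 2)) ≤ t ^ q :=
    Real.rpow_le_rpow_of_exponent_ge ht ht1 (le_max_left _ _)
  refine h1.trans ?_
  have h2 : 0 < t ^ q := Real.rpow_pos_of_pos ht q
  have h3 := mul_le_mul_of_nonneg_right h h2.le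
  rwa [mul_assoc, ← Real.rpow_add ht, neg_add_cancel, Real.rpow_zero, one_mul, mul_one] at h3

/-- The map `t ↦ t ^ (1 - q)` desingularizes: a division-free concavity inequality. -/
theorem one_sub_mul_sub_le_rpow {q u v : ℝ} (hq0 : 0 ≤ q) (hq1 : q ≤ 1) (hu : 0 ≤ u)
    (hv : 0 ≤ v) : (1 - q) * (u - v) ≤ u ^ q * (u ^ (1 - q) - v ^ (1 - q)) := by
  have h1 := Real.geom_mean_le_arith_mean2_weighted hq0 (sub_nonneg.2 hq1) hu hv (by ring)
  have h2 : u ^ q * u ^ (1 - q) = u := by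
    rw [← Real.rpow_add' hu (by norm_num)]; simp
  rw [mul_sub (u ^ q), h2]
  linarith

/-- Trapping and finite-length argument for a descent sequence with a Kurdyka–Łojasiewicz
inequality near one of its cluster points. -/
theorem norm_sub_le_rpow_of_descent {E : Type*} [NormedAddCommGroup E] {x : ℕ → E} {xb : E}
    {h r : ℕ → ℝ} {σ K D q ρ : ℝ} {N : ℕ} (hσ : 0 < σ) (hK : 0 < K) (hD : 0 < D)
    (hq0 : 0 < q) (hq1 : q < 1) (hρ : 0 < ρ) (hh : ∀ k ≥ N, 0 ≤ h k) (hr : ∀ k ≥ N, 0 ≤ r k)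
    (hlim : Tendsto h atTop (nhds 0)) (hacc : MapClusterPt xb atTop x)
    (hstep : ∀ k ≥ N, ‖x (k + 1) - x k‖ ≤ D * r k)
    (hdesc : ∀ k ≥ N, h (k + 1) + σ * r k ^ 2 ≤ h k)
    (hKL : ∀ k ≥ N, x k ∈ Metric.ball xb ρ → h k ^ q ≤ K * r k) :
    ∃ C > 0, ∃ N' ≥ N, ∀ k ≥ N', ‖x k - xb‖ ≤ C * h k ^ (1 - q) ∧ h k ^ q ≤ K * r k := by
  set C := D * (K / (σ * (1 - q))) with hC
  have h1q : 0 < 1 - q := sub_pos.2 hq1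
  have hCpos : 0 < C := by positivity
  have key : ∀ k ≥ N, x k ∈ Metric.ball xb ρ →
      ‖x (k + 1) - x k‖ ≤ C * (h k ^ (1 - q) - h (k + 1) ^ (1 - q)) := by
    intro k hk hx
    have hk1 : k + 1 ≥ N := by omega
    have hd := hdesc k hk
    have hle : h (k + 1) ≤ h k := by nlinarith [sq_nonneg (r k)]
    have hφ : 0 ≤ h k ^ (1 - q) - h (k + 1) ^ (1 - q) :=
      sub_nonneg.2 (Real.rpow_le_rpow (hh _ hk1) hle h1q.le)
    have hrk : r k ≤ K / (σ * (1 - q)) * (h k ^ (1 - q) - h (k + 1) ^ (1 - q)) := by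
      rcases (hr k hk).eq_or_lt with h0 | h0
      · rw [← h0]; positivity
      · have e1 := one_sub_mul_sub_le_rpow hq0.le hq1.le (hh k hk) (hh _ hk1)
        have e2 := e1.trans (mul_le_mul_of_nonneg_right (hKL k hk hx) hφ)
        have e3 : (1 - q) * (σ * r k ^ 2) ≤ (1 - q) * (h k - h (k + 1)) := by gcongr; linarith
        rw [div_mul_eq_mul_div, le_div_iff₀ (by positivity)]
        refine le_of_mul_le_mul_left ?_ h0
        nlinarith
    calc _ ≤ D * r k := hstep k hk
      _ ≤ D * (K / (σ * (1 - q)) * (h k ^ (1 - q) - h (k + 1) ^ (1 - q))) := by gcongr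
      _ = _ := by rw [hC]; ring
  have hφlim : Tendsto (fun k => C * h k ^ (1 - q)) atTop (nhds 0) := by
    have := (hlim.rpow_const (p := 1 - q) (Or.inr h1q.le)).const_mul C
    simpa [Real.zero_rpow h1q.ne'] using this
  have hfreq : ∀ ε > 0, ∀ m, ∃ k ≥ m, ‖x k - xb‖ < ε := by
    intro ε hε m
    obtain ⟨k, hk, hx⟩ := frequently_atTop.1 (hacc.frequently (Metric.ball_mem_nhds xb hε)) m
    exact ⟨k, hk, by simpa [dist_eq_norm] using hx⟩
  obtain ⟨N1, hN1⟩ := eventually_atTop.1 (hφlim.eventually (gt_mem_nhds (half_pos hρ)))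
  obtain ⟨m, hm, hxm⟩ := hfreq (ρ / 2) (half_pos hρ) (max N N1)
  have hmN : N ≤ m := (le_max_left _ _).trans hm
  have hφm := hN1 m ((le_max_right _ _).trans hm)
  have tel : ∀ j, ∀ p ≥ m, (∀ i ≥ p, i < p + j → x i ∈ Metric.ball xb ρ) →
      ‖x (p + j) - x p‖ ≤ C * h p ^ (1 - q) - C * h (p + j) ^ (1 - q) := by
    intro j p hp
    induction j with
    | zero => intro _; simp
    | succ j ih =>
      intro hi
      have h1 := ih (fun i h1 h2 => hi i h1 (by omega))
      have h2 := key (p + j) (by omega) (hi (p + j) (by omega) (by omega))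
      have h3 := norm_sub_le_norm_sub_add_norm_sub (x (p + j + 1)) (x (p + j)) (x p)
      rw [← add_assoc]
      linarith
  have nn : ∀ k ≥ m, 0 ≤ C * h k ^ (1 - q) := fun k hk =>
    mul_nonneg hCpos.le (Real.rpow_nonneg (hh k (by omega)) _)
  have trap : ∀ i ≥ m, x i ∈ Metric.ball xb ρ := by
    intro i
    induction i using Nat.strong_induction_on with
    | _ i ih =>
      intro hi
      obtain ⟨j, rfl⟩ := Nat.exists_eq_add_of_le hi
      have h1 := tel j m le_rfl (fun i h1 h2 => ih i h2 h1)
      have h2 := nn (m + j) hi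
      have h3 := norm_sub_le_norm_sub_add_norm_sub (x (m + j)) (x m) xb
      rw [Metric.mem_ball, dist_eq_norm]
      linarith
  refine ⟨C, hCpos, m, hmN, fun k hk => ⟨?_, hKL k (by omega) (trap k hk)⟩⟩
  refine le_of_forall_pos_lt_add fun ε hε => ?_
  obtain ⟨i, hi, hxi⟩ := hfreq ε hε k
  obtain ⟨j, rfl⟩ := Nat.exists_eq_add_of_le hi
  have h1 := tel j k hk (fun i h1 _ => trap i (by omega))
  have h2 := nn (k + j) (by omega)
  have h3 := norm_sub_le_norm_sub_add_norm_sub (x k) (x (k + j)) xb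
  rw [norm_sub_rev (x k) (x (k + j))] at h3
  linarith

/-- An eventual geometric bound holds for all indices after enlarging the constant. -/
theorem exists_forall_le_mul_pow {a : ℕ → ℝ} {C c : ℝ} {N : ℕ} (hc : 0 < c)
    (h : ∀ k ≥ N, a k ≤ C * c ^ k) : ∃ C' > 0, ∀ k, a k ≤ C' * c ^ k := by
  have hs : ∀ k ∈ Finset.range N, 0 ≤ |a k| / c ^ k := fun k _ => by positivity
  refine ⟨|C| + ∑ k ∈ Finset.range N, |a k| / c ^ k + 1, ?_, fun k => ?_⟩
  · have := Finset.sum_nonneg hs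
    positivity
  · rw [← div_le_iff₀ (by positivity)]
    rcases lt_or_ge k N with hk | hk
    · have h1 := Finset.single_le_sum hs (Finset.mem_range.2 hk)
      have h2 : a k / c ^ k ≤ |a k| / c ^ k := by gcongr; exact le_abs_self _
      linarith [abs_nonneg C]
    · have h1 : a k / c ^ k ≤ C := (div_le_iff₀ (by positivity)).2 (h k hk)
      linarith [le_abs_self C, Finset.sum_nonneg hs]

/-- Geometric decay from a one-step contraction. -/
theorem exists_le_mul_pow_of_step {h : ℕ → ℝ} {s : ℝ} {N : ℕ} (hs : 0 < s)
    (hh : ∀ k ≥ N, 0 ≤ h k) (hstep : ∀ k ≥ N, h (k + 1) + s * h k ≤ h k) :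
    ∃ C ≥ 0, ∃ c ∈ Ioo (0 : ℝ) 1, ∀ k ≥ N, h k ≤ C * c ^ k := by
  set c := max (1 - s) (1 / 2) with hc
  have hc0 : 0 < c := lt_max_of_lt_right (by norm_num)
  have hc1 : c < 1 := max_lt (by linarith) (by norm_num)
  have hhN := hh N le_rfl
  refine ⟨h N / c ^ N, by positivity, c, ⟨hc0, hc1⟩, fun k hk => ?_⟩
  induction k, hk using Nat.le_induction with
  | base => rw [div_mul_cancel₀ _ (by positivity)]
  | succ k hk ih =>
    have h1 : h (k + 1) ≤ c * h k := by
      nlinarith [hstep k hk, mul_le_mul_of_nonneg_right (le_max_left (1 - s) (1 / 2)) (hh k hk)]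
    calc h (k + 1) ≤ c * h k := h1
      _ ≤ c * (h N / c ^ N * c ^ k) := by gcongr
      _ = _ := by ring

/-- Sublinear decay `O(k ^ (-1/a))` from the recursion `h (k+1) ≤ h k - s * h k ^ (1 + a)`. -/
theorem exists_le_mul_rpow_of_step {h : ℕ → ℝ} {s a : ℝ} {N : ℕ} (hs : 0 < s) (ha : 0 < a)
    (hh : ∀ k ≥ N, 0 ≤ h k) (hstep : ∀ k ≥ N, h (k + 1) + s * h k ^ (1 + a) ≤ h k) :
    ∃ C > 0, ∃ N' ≥ N, ∀ k ≥ N', h k ≤ C * (k : ℝ) ^ (-(1 / a)) := by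
  have hinv : ∀ k ≥ N, a * s * ((k : ℝ) - N) * h k ^ a ≤ 1 := by
    intro k hk
    induction k, hk using Nat.le_induction with
    | base => simp
    | succ k hk ih =>
      have h0 := hh k hk
      have h1 := hh (k + 1) (by omega)
      have hst := hstep k hk
      rcases h1.eq_or_lt with hz | hpos
      · rw [← hz, Real.zero_rpow ha.ne']; simp
      have hkpos : 0 < h k := by nlinarith [Real.rpow_nonneg h0 (1 + a)]
      set w := h k ^ a with hw
      have hwpos : 0 < w := Real.rpow_pos_of_pos hkpos a
      have hfac : h k ^ (1 + a) = h k * w := by rw [Real.rpow_add hkpos, Real.rpow_one]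
      rw [hfac] at hst
      have hle : h (k + 1) ≤ h k * Real.exp (-(s * w)) := by
        have := Real.add_one_le_exp (-(s * w))
        nlinarith
      have hle2 : h (k + 1) ^ a ≤ w * Real.exp (-(a * (s * w))) := by
        calc h (k + 1) ^ a ≤ (h k * Real.exp (-(s * w))) ^ a :=
              Real.rpow_le_rpow h1 hle ha.le
          _ = _ := by
              rw [Real.mul_rpow h0 (Real.exp_pos _).le, ← Real.exp_mul]
              congr 2; ring
      have hNk : (0 : ℝ) ≤ (k : ℝ) - N := sub_nonneg.2 (by exact_mod_cast hk)
      have hexp : (1 + a * (s * w)) * Real.exp (-(a * (s * w))) ≤ 1 := by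
        have h1 := Real.add_one_le_exp (a * (s * w))
        have h2 : Real.exp (a * (s * w)) * Real.exp (-(a * (s * w))) = 1 := by
          rw [← Real.exp_add]; simp
        nlinarith [Real.exp_pos (-(a * (s * w)))]
      push_cast
      calc a * s * ((k : ℝ) + 1 - N) * h (k + 1) ^ a
          ≤ a * s * ((k : ℝ) + 1 - N) * (w * Real.exp (-(a * (s * w)))) := by
            refine mul_le_mul_of_nonneg_left hle2 (mul_nonneg (by positivity) (by linarith))
        _ = (a * s * ((k : ℝ) - N) * w + a * (s * w)) * Real.exp (-(a * (s * w))) := by ring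
        _ ≤ (1 + a * (s * w)) * Real.exp (-(a * (s * w))) := by gcongr
        _ ≤ 1 := hexp
  refine ⟨(a * s / 2) ^ (-(1 / a)), by positivity, 2 * N + 1, by omega, fun k hk => ?_⟩
  have hkN : (2 * N + 1 : ℝ) ≤ k := by exact_mod_cast hk
  have hkpos : (0 : ℝ) < k := by linarith [Nat.cast_nonneg (α := ℝ) N]
  have h0 := hh k (by omega)
  have hb : a * s / 2 * k * h k ^ a ≤ 1 := by
    refine le_trans ?_ (hinv k (by omega))
    have : a * s / 2 * k ≤ a * s * ((k : ℝ) - N) := by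
      have : (0 : ℝ) < a * s := by positivity
      nlinarith
    exact mul_le_mul_of_nonneg_right this (Real.rpow_nonneg h0 _)
  have hb2 : h k ^ a ≤ (a * s / 2 * k)⁻¹ := by
    rw [← one_div, le_div_iff₀ (by positivity)]; linarith
  rw [← Real.mul_rpow (by positivity) hkpos.le]
  calc h k = (h k ^ a) ^ (1 / a) := by
        rw [← Real.rpow_mul h0, mul_one_div_cancel ha.ne', Real.rpow_one]
    _ ≤ ((a * s / 2 * k)⁻¹) ^ (1 / a) :=
        Real.rpow_le_rpow (Real.rpow_nonneg h0 _) hb2 (by positivity)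
    _ = _ := by rw [Real.inv_rpow (by positivity), ← Real.rpow_neg (by positivity)]

/-- A sequence bounded below with sufficient decrease `σ r²` converges and `r` tends to `0`. -/
theorem exists_tendsto_of_descent {h r : ℕ → ℝ} {σ b : ℝ} {N : ℕ} (hσ : 0 < σ)
    (hb : ∀ k ≥ N, b ≤ h k) (hdesc : ∀ k ≥ N, h (k + 1) + σ * r k ^ 2 ≤ h k) :
    ∃ l, Tendsto h atTop (nhds l) ∧ Tendsto r atTop (nhds 0) ∧ ∀ k ≥ N, l ≤ h k := by
  have hanti : Antitone fun k => h (k + N) := antitone_nat_of_succ_le fun k => by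
    have := hdesc (k + N) (by omega)
    rw [add_right_comm]
    nlinarith [sq_nonneg (r (k + N))]
  have hbdd : BddBelow (range fun k => h (k + N)) :=
    ⟨b, by rintro _ ⟨k, rfl⟩; exact hb _ (by omega)⟩
  have hlim : Tendsto h atTop (nhds (⨅ k, h (k + N))) :=
    (tendsto_add_atTop_iff_nat N).1 (tendsto_atTop_ciInf hanti hbdd)
  refine ⟨_, hlim, ?_, fun k hk => ?_⟩
  · have h1 : Tendsto (fun k => √((h k - h (k + 1)) / σ)) atTop (nhds 0) := by
      have := ((hlim.sub ((tendsto_add_atTop_iff_nat 1).2 hlim)).div_const σ).sqrt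
      simpa using this
    refine squeeze_zero_norm' ?_ h1
    filter_upwards [eventually_ge_atTop N] with k hk
    refine Real.le_sqrt_of_sq_le ?_
    rw [Real.norm_eq_abs, sq_abs, le_div_iff₀ hσ]
    linarith [hdesc k hk]
  · obtain ⟨j, rfl⟩ := Nat.exists_eq_add_of_le' hk
    exact ciInf_le hbdd j

/-- The PLK condition with exponent `q` bounds the function gap by the gradient, with the exponent
raised to `max q (1/2)`. -/
theorem ExpPLKCondition.exists_rpow_le {n : ℕ} {f : EuclideanSpace ℝ (Fin n) → ℝ}
    {xb : EuclideanSpace ℝ (Fin n)} {M q : ℝ} (h : ExpPLKCondition f xb M q) :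
    ∃ ρ > 0, ∃ ε > 0, ∀ x ∈ Metric.ball xb ρ, f xb < f x → f x < f xb + ε →
      (f x - f xb) ^ (max q (1 / 2)) ≤ M * (1 - q) * ‖gradient f x‖ := by
  obtain ⟨η, U, hη, hU, hP⟩ := h
  obtain ⟨ρ, hρ, hball⟩ := Metric.mem_nhds_iff.1 hU
  refine ⟨ρ, hρ, min η 1, lt_min hη one_pos, fun x hx h1 h2 => ?_⟩
  have h3 := hP x (hball hx) h1 (by linarith [min_le_left η 1])
  refine rpow_max_half_le (sub_pos.2 h1) (by linarith [min_le_right η 1]) ?_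
  linarith

/-- The Lyapunov value satisfies a Kurdyka–Łojasiewicz inequality when the function does. -/
theorem rpow_add_sq_le {t w a m B p : ℝ} (ha : 0 ≤ a) (hm : 0 ≤ m) (hp0 : 1 / 2 ≤ p)
    (hp1 : p ≤ 1) (hw0 : 0 ≤ w) (hw1 : w ≤ 1) (hB : 0 ≤ B) (hsum : 0 ≤ a * t + m * w ^ 2)
    (ht : 0 < t → t ^ p ≤ B) : (a * t + m * w ^ 2) ^ p ≤ a ^ p * B + m ^ p * w := by
  have hp : 0 < p := by linarith
  have hw : (m * w ^ 2) ^ p ≤ m ^ p * w := by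
    rw [Real.mul_rpow hm (sq_nonneg w)]
    refine mul_le_mul_of_nonneg_left ?_ (Real.rpow_nonneg hm p)
    calc (w ^ 2) ^ p = w ^ (2 * p) := by rw [Real.rpow_mul hw0, Real.rpow_two]
      _ ≤ w ^ (1 : ℝ) :=
        Real.rpow_le_rpow_of_exponent_ge_of_imp hw0 hw1 (by linarith)
          (fun _ h => by linarith)
      _ = w := Real.rpow_one w
  rcases lt_or_ge 0 t with h | h
  · calc (a * t + m * w ^ 2) ^ p ≤ (a * t) ^ p + (m * w ^ 2) ^ p :=
          Real.rpow_add_le_add_rpow (by positivity) (by positivity) hp.le hp1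
      _ ≤ a ^ p * B + m ^ p * w := by
          rw [Real.mul_rpow ha h.le]
          gcongr
          exact ht h
  · calc (a * t + m * w ^ 2) ^ p ≤ (m * w ^ 2) ^ p :=
          Real.rpow_le_rpow hsum (by nlinarith) hp.le
      _ ≤ a ^ p * B + m ^ p * w := by
          have := mul_nonneg (Real.rpow_nonneg ha p) hB
          linarith

/-- The inertial step length is controlled by the previous step and the search direction. -/
theorem norm_inertial_step_le {E : Type*} [NormedAddCommGroup E] [NormedSpace ℝ E] {b τ : ℝ}
    (hb0 : 0 ≤ b) (hb1 : b ≤ 1) (hτ : 0 ≤ τ) (d g : E) :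
    ‖b • d - τ • g‖ ≤ (1 + τ) * (‖d‖ + ‖g‖) := by
  have h := norm_sub_le (b • d) (τ • g)
  rw [norm_smul, norm_smul, Real.norm_of_nonneg hb0, Real.norm_of_nonneg hτ] at h
  have h1 : b * ‖d‖ ≤ 1 * ‖d‖ := by gcongr
  have h2 : 0 ≤ τ * ‖d‖ := by positivity
  linarith [norm_nonneg g]

/-- The gradient at the base point is controlled by the previous step and the inexact gradient. -/
theorem norm_gradient_le_of_relative_error {E : Type*} [NormedAddCommGroup E] [NormedSpace ℝ E]
    {G : E → E} {L ν c cbar : ℝ} (hG : ∀ x y, ‖G x - G y‖ ≤ L * ‖x - y‖) (hL : 0 ≤ L)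
    (hν : ν ≤ 1) (hc0 : 0 ≤ c) (hc : c ≤ cbar) {u d g : E}
    (hg : ‖g - G (u + c • d)‖ ≤ ν * ‖g‖) :
    ‖G u‖ ≤ (2 + L * cbar) * (‖d‖ + ‖g‖) := by
  have h1 := hG u (u + c • d)
  rw [sub_add_cancel_left, norm_neg, norm_smul, Real.norm_of_nonneg hc0] at h1
  have h2 := norm_sub_norm_le (G u) (G (u + c • d))
  have h3 := norm_sub_norm_le (G (u + c • d)) g
  rw [norm_sub_rev] at h3
  have h4 : L * (c * ‖d‖) ≤ L * (cbar * ‖d‖) := by gcongr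
  have h5 : ν * ‖g‖ ≤ 1 * ‖g‖ := by gcongr
  have h6 : 0 ≤ L * cbar * ‖g‖ := mul_nonneg (mul_nonneg hL (hc0.trans hc)) (norm_nonneg g)
  linarith [norm_nonneg d]

/-- A weighted sum of squares dominates a multiple of the squared sum. -/
theorem min_half_mul_add_sq_le {a b : ℝ} (hab : 0 ≤ min a b) (u v : ℝ) :
    min a b / 2 * (u + v) ^ 2 ≤ a * u ^ 2 + b * v ^ 2 := by
  have e3 : (u + v) ^ 2 ≤ 2 * (u ^ 2 + v ^ 2) := by nlinarith [sq_nonneg (u - v)]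
  have e4 : min a b / 2 * (u + v) ^ 2 ≤ min a b / 2 * (2 * (u ^ 2 + v ^ 2)) := by gcongr
  have e1 := mul_le_mul_of_nonneg_right (min_le_left a b) (sq_nonneg u)
  have e2 := mul_le_mul_of_nonneg_right (min_le_right a b) (sq_nonneg v)
  linarith

/-- IGDm iterates admit a vanishing Lyapunov sequence `h` that controls the distance to the
cluster point and satisfies a power-type decrease; moreover the cluster point is stationary. -/
theorem IGDm_exists_lyapunov {n : ℕ}
    {f : EuclideanSpace ℝ (Fin n) → ℝ} (hdiff : Differentiable ℝ f) {L : ℝ} (hL : 0 < L)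
    (hlip : ∀ x y : EuclideanSpace ℝ (Fin n),
      ‖gradient f x - gradient f y‖ ≤ L * ‖x - y‖)
    {τ ν βbar δbar : ℝ} (hτ : 0 < τ) (hν : ν ∈ Set.Ioo (0:ℝ) 1)
    {β γ : ℕ → ℝ} (hβnn : ∀ k, 0 ≤ β k) (hγnn : ∀ k, 0 ≤ γ k)
    (hβbar : ∀ k, β k ≤ βbar) (hβbar1 : βbar < 1)
    (hδbar : ∀ k, |β k - γ k| ≤ δbar)
    {x g : ℕ → EuclideanSpace ℝ (Fin n)}
    (hupd : ∀ k, 1 ≤ k → x (k+1) = x k + β k • (x k - x (k-1)) - τ • g k)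
    (hg : ∀ k, 1 ≤ k → ‖g k - gradient f (x k + γ k • (x k - x (k-1)))‖ ≤ ν * ‖g k‖)
    (hparam : max (L*τ) (2*L*τ*δbar + (L*τ+1)*βbar^2) < 1 - ν)
    (hbdd : ∃ m : ℝ, ∀ k, m ≤ f (x k))
    {xb : EuclideanSpace ℝ (Fin n)} (hacc : MapClusterPt xb atTop x)
    {M q : ℝ} (hM : 0 < M) (hq1 : q < 1) (hPLK : ExpPLKCondition f xb M q) :
    gradient f xb = 0 ∧ ∃ C > 0, ∃ s > 0, ∃ N : ℕ, ∃ h : ℕ → ℝ,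
      Tendsto h atTop (nhds 0) ∧ (∀ k ≥ N, 0 ≤ h k) ∧
      (∀ k ≥ N, ‖x k - xb‖ ≤ C * h k ^ (1 - max q (1 / 2))) ∧
      (∀ k ≥ N, h (k + 1) + s * h k ^ (2 * max q (1 / 2)) ≤ h k) := by
  have hf : ∀ x, HasGradientAt f (gradient f x) x := fun x => (hdiff x).hasGradientAt
  obtain ⟨hp1, hp2⟩ := max_lt_iff.1 hparam
  have hδ : 0 ≤ δbar := (abs_nonneg _).trans (hδbar 0)
  have hLτ : 0 < L * τ := mul_pos hL hτ
  obtain ⟨A, hA⟩ : ∃ A, A = L * τ * δbar + (L * τ + 1) * βbar ^ 2 := ⟨_, rfl⟩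
  obtain ⟨B, hB⟩ : ∃ B, B = 1 - ν - L * τ * δbar := ⟨_, rfl⟩
  have hA0 : 0 ≤ A := by rw [hA]; positivity
  have hAB : A < B := by rw [hA, hB]; linarith
  set m := (A + B) / 2 with hm
  have hm0 : 0 < m := by linarith
  set G := (1 - ν - L * τ) * τ ^ 2 with hG
  have hG0 : 0 < G := mul_pos (by linarith) (by positivity)
  set d : ℕ → EuclideanSpace ℝ (Fin n) := fun k => x k - x (k - 1) with hd
  set h : ℕ → ℝ := fun k => 2 * τ * (f (x k) - f xb) + m * ‖d k‖ ^ 2 with hh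
  set r : ℕ → ℝ := fun k => ‖d k‖ + ‖g k‖ with hr
  set σ := min ((B - A) / 2) G / 2 with hσ
  have hσ0 : 0 < σ := half_pos (lt_min (by linarith) hG0)
  have hr0 : ∀ k, 0 ≤ r k := fun k => by positivity
  have hdesc : ∀ k ≥ 1, h (k + 1) + σ * r k ^ 2 ≤ h k := by
    intro k hk
    have h1 := inertial_step_decrease_s11 hf hlip hL hτ hν.1.le (hβnn k) (hβbar k) (hδbar k)
      (hupd k hk) (hg k hk)
    rw [← hA, ← hB, ← hG] at h1
    have h2 : σ * r k ^ 2 ≤ (B - A) / 2 * ‖d k‖ ^ 2 + G * ‖g k‖ ^ 2 :=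
      min_half_mul_add_sq_le (le_min (by linarith) hG0.le) _ _
    have h3 : d (k + 1) = x (k + 1) - x k := rfl
    have h4 : x k - x (k - 1) = d k := rfl
    rw [← h3, h4] at h1
    have h5 : (B - A) / 2 * ‖d (k + 1)‖ ^ 2 ≥ 0 :=
      mul_nonneg (by linarith) (sq_nonneg _)
    simp only [hh, hm]
    linarith
  obtain ⟨b, hb⟩ := hbdd
  obtain ⟨l, hl, hrlim, hlh⟩ := exists_tendsto_of_descent (b := 2 * τ * (b - f xb)) hσ0
    (fun k _ => by
      have h1 : 2 * τ * (b - f xb) ≤ 2 * τ * (f (x k) - f xb) := by gcongr; exact hb k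
      have h2 : 0 ≤ m * ‖d k‖ ^ 2 := by positivity
      simp only [hh]
      linarith) hdesc
  have hdlim : Tendsto (fun k => ‖d k‖) atTop (nhds 0) :=
    squeeze_zero (fun k => norm_nonneg _) (fun k => le_add_of_nonneg_right (norm_nonneg _)) hrlim
  have hflim : Tendsto (fun k => f (x k)) atTop (nhds (l / (2 * τ) + f xb)) := by
    have h1 := ((hl.sub ((hdlim.pow 2).const_mul m)).div_const (2 * τ)).add_const (f xb)
    have h2 : ∀ k, (h k - m * ‖d k‖ ^ 2) / (2 * τ) + f xb = f (x k) := by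
      intro k
      simp only [hh]
      field_simp
      ring
    simpa [h2] using h1
  have hl0 : l = 0 := by
    have h1 := (hacc.continuousAt_comp hdiff.continuous.continuousAt).clusterPt.mono hflim
    have h2 := eq_of_nhds_neBot h1
    have h3 : l / (2 * τ) = 0 := by linarith
    rcases div_eq_zero_iff.1 h3 with h | h
    · exact h
    · exact absurd h (by positivity)
  subst hl0
  rw [zero_div, zero_add] at hflim
  set K₀ := 2 + L * (1 + δbar) with hK₀
  have hgrad : ∀ k ≥ 1, ‖gradient f (x k)‖ ≤ K₀ * r k := by
    intro k hk
    have h1 := (abs_le.1 (hδbar k)).1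
    exact norm_gradient_le_of_relative_error hlip hL.le hν.2.le (hγnn k)
      (by linarith [hβbar k]) (hg k hk)
  obtain ⟨ρ, hρ, ε, hε, hP⟩ := hPLK.exists_rpow_le
  set p := max q (1 / 2) with hp
  have hp_half : 1 / 2 ≤ p := le_max_right _ _
  have hp_one : p < 1 := max_lt hq1 (by norm_num)
  have h1q : 0 < 1 - q := sub_pos.2 hq1
  obtain ⟨N, hN⟩ := eventually_atTop.1 ((hflim.eventually
    (gt_mem_nhds (lt_add_of_pos_right (f xb) hε))).and
    ((hdlim.eventually (gt_mem_nhds one_pos)).and (eventually_ge_atTop 1)))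
  set K := (2 * τ) ^ p * (M * (1 - q) * K₀) + m ^ p with hK
  have hK0 : 0 < K := by positivity
  have hKL : ∀ k ≥ N, x k ∈ Metric.ball xb ρ → h k ^ p ≤ K * r k := by
    intro k hk hx
    obtain ⟨h1, h2, h3⟩ := hN k hk
    have h4 := rpow_add_sq_le (B := M * (1 - q) * (K₀ * r k)) (p := p) (a := 2 * τ) (m := m)
      (w := ‖d k‖) (t := f (x k) - f xb) (by positivity) hm0.le hp_half hp_one.le
      (norm_nonneg _) h2.le (by have := hr0 k; positivity) (hlh k h3)
      (fun ht => (hP _ hx (sub_pos.1 ht) h1).trans (by gcongr; exact hgrad k h3))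
    have h5 : m ^ p * ‖d k‖ ≤ m ^ p * r k := by
      gcongr
      exact le_add_of_nonneg_right (norm_nonneg _)
    calc h k ^ p ≤ _ := h4
      _ ≤ (2 * τ) ^ p * (M * (1 - q) * (K₀ * r k)) + m ^ p * r k := by gcongr
      _ = K * r k := by rw [hK]; ring
  have hstep : ∀ k ≥ N, ‖x (k + 1) - x k‖ ≤ (1 + τ) * r k := by
    intro k hk
    have h1 : x (k + 1) - x k = β k • d k - τ • g k := by
      rw [hupd k (hN k hk).2.2]; simp only [hd]; abel
    rw [h1]
    exact norm_inertial_step_le (hβnn k) ((hβbar k).trans hβbar1.le) hτ.le _ _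
  obtain ⟨C, hC, N', hN', hfin⟩ := norm_sub_le_rpow_of_descent hσ0 hK0
    (by positivity : 0 < 1 + τ) (by linarith) hp_one hρ (fun k hk => hlh k (hN k hk).2.2)
    (fun k _ => hr0 k) hl hacc hstep (fun k hk => hdesc k (hN k hk).2.2) hKL
  have hpos : ∀ k ≥ N', 0 ≤ h k := fun k hk => hlh k (hN k (by omega)).2.2
  refine ⟨?_, C, hC, σ / K ^ 2, by positivity, N', h, hl, hpos, fun k hk => (hfin k hk).1,
    fun k hk => ?_⟩
  · have h1 : Tendsto (fun k => K₀ * r k + L * (C * h k ^ (1 - p))) atTop (nhds 0) := by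
      have e1 := hl.rpow_const (p := 1 - p) (Or.inr (by linarith))
      rw [Real.zero_rpow (by linarith)] at e1
      simpa using (hrlim.const_mul K₀).add ((e1.const_mul C).const_mul L)
    have h2 : ‖gradient f xb‖ ≤ 0 := by
      refine ge_of_tendsto h1 ?_
      filter_upwards [eventually_ge_atTop N'] with k hk
      have e1 := hgrad k (hN k (by omega)).2.2
      have e2 := hlip xb (x k)
      have e3 := norm_sub_norm_le (gradient f xb) (gradient f (x k))
      have e4 : L * ‖xb - x k‖ ≤ L * (C * h k ^ (1 - p)) := by
        rw [norm_sub_rev]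
        gcongr
        exact (hfin k hk).1
      linarith
    exact norm_le_zero_iff.1 h2
  · have h1 := hdesc k (hN k (by omega)).2.2
    have h2 : h k ^ (2 * p) ≤ (K * r k) ^ 2 := by
      rw [mul_comm, Real.rpow_mul (hpos k hk), Real.rpow_two]
      have := (hfin k hk).2
      have := Real.rpow_nonneg (hpos k hk) p
      gcongr
    have h3 : σ / K ^ 2 * h k ^ (2 * p) ≤ σ / K ^ 2 * (K * r k) ^ 2 := by gcongr
    have h4 : σ / K ^ 2 * (K * r k) ^ 2 = σ * r k ^ 2 := by field_simp
    linarith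

/-- Global convergence rates for IGDm under the exponential PLK condition. -/
theorem IGDm_global_rates_expPLK {n : ℕ}
    (f : EuclideanSpace ℝ (Fin n) → ℝ)
    (hdiff : Differentiable ℝ f)
    (L : ℝ) (hL : 0 < L)
    (hlip : ∀ x y : EuclideanSpace ℝ (Fin n),
      ‖gradient f x - gradient f y‖ ≤ L * ‖x - y‖)
    (τ ν βbar δbar : ℝ) (hτ : 0 < τ) (hν : ν ∈ Set.Ioo (0:ℝ) 1)
    (β γ : ℕ → ℝ) (hβnn : ∀ k, 0 ≤ β k) (hγnn : ∀ k, 0 ≤ γ k)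
    (hβbar : ∀ k, β k ≤ βbar) (hβbar1 : βbar < 1)
    (hδbar : ∀ k, |β k - γ k| ≤ δbar)
    (x xin xex g : ℕ → EuclideanSpace ℝ (Fin n))
    (hx01 : x 0 = x 1)
    (hxin : ∀ k, 1 ≤ k → xin k = x k + β k • (x k - x (k-1)))
    (hxex : ∀ k, 1 ≤ k → xex k = x k + γ k • (x k - x (k-1)))
    (hupd : ∀ k, 1 ≤ k → x (k+1) = xin k - τ • g k)
    (hg : ∀ k, 1 ≤ k → ‖g k - gradient f (xex k)‖ ≤ ν * ‖g k‖)
    (hparam : max (L*τ) (2*L*τ*δbar + (L*τ+1)*βbar^2) < 1 - ν)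
    (hbdd : ∃ m : ℝ, ∀ k, m ≤ f (x k))
    (hne : ∀ k, 1 ≤ k → gradient f (xex k) ≠ 0)
    (xb : EuclideanSpace ℝ (Fin n))
    (hacc : MapClusterPt xb atTop x)
    (M q : ℝ) (hM : 0 < M) (hq : q ∈ Set.Ico (0:ℝ) 1)
    (hPLK : ExpPLKCondition f xb M q) :
    Tendsto x atTop (nhds xb) ∧
    (q ≤ 1/2 → ∃ C > (0:ℝ), ∃ c ∈ Set.Ioo (0:ℝ) 1, ∀ k : ℕ,
      ‖x k - xb‖ ≤ C * c ^ k ∧ ‖gradient f (x k)‖ ≤ C * c ^ k ∧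
      |f (x k) - f xb| ≤ C * c ^ k) ∧
    (1/2 < q → ∃ C > (0:ℝ), ∃ N : ℕ, ∀ k ≥ N,
      ‖x k - xb‖ ≤ C * (k : ℝ) ^ (-(1 - q) / (2*q - 1)) ∧
      ‖gradient f (x k)‖ ≤ C * (k : ℝ) ^ (-(1 - q) / (2*q - 1)) ∧
      f (x k) - f xb ≤ C * (k : ℝ) ^ (-(2 - 2*q) / (2*q - 1))) := by
  have hupd' : ∀ k, 1 ≤ k → x (k+1) = x k + β k • (x k - x (k-1)) - τ • g k := fun k hk => by
    rw [hupd k hk, hxin k hk]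
  have hg' : ∀ k, 1 ≤ k → ‖g k - gradient f (x k + γ k • (x k - x (k-1)))‖ ≤ ν * ‖g k‖ :=
    fun k hk => by rw [← hxex k hk]; exact hg k hk
  obtain ⟨hcrit, C, hC, s, hs, N, h, hl, hpos, hdist, hrec⟩ :=
    IGDm_exists_lyapunov hdiff hL hlip hτ hν hβnn hγnn hβbar hβbar1 hδbar hupd' hg' hparam hbdd
      hacc hM hq.2 hPLK
  have hf : ∀ x, HasGradientAt f (gradient f x) x := fun x => (hdiff x).hasGradientAt
  have hgrad : ∀ k, ‖gradient f (x k)‖ ≤ L * ‖x k - xb‖ := fun k => by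
    simpa [hcrit] using hlip (x k) xb
  have hval : ∀ k, |f (x k) - f xb| ≤ L / 2 * ‖x k - xb‖ ^ 2 := fun k => by
    simpa [hcrit] using HasGradientAt.abs_sub_sub_inner_le hf hlip (x k) xb
  refine ⟨?_, fun hq2 => ?_, fun hq2 => ?_⟩
  · have hp : 0 < 1 - max q (1 / 2) := sub_pos.2 (max_lt hq.2 (by norm_num))
    have h1 : Tendsto (fun k => C * h k ^ (1 - max q (1 / 2))) atTop (nhds 0) := by
      have e1 := hl.rpow_const (p := 1 - max q (1 / 2)) (Or.inr hp.le)
      rw [Real.zero_rpow hp.ne'] at e1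
      simpa using e1.const_mul C
    rw [tendsto_iff_norm_sub_tendsto_zero]
    refine squeeze_zero' (Eventually.of_forall fun k => norm_nonneg _) ?_ h1
    filter_upwards [eventually_ge_atTop N] with k hk using hdist k hk
  · rw [max_eq_right hq2] at hdist hrec
    obtain ⟨D, hD, c, ⟨hc0, hc1⟩, hgeo⟩ := exists_le_mul_pow_of_step hs hpos
      (fun k hk => by simpa using hrec k hk)
    obtain ⟨C₁, hC₁, hb⟩ : ∃ C₁ > 0, ∀ k, ‖x k - xb‖ ≤ C₁ * √c ^ k := by
      refine exists_forall_le_mul_pow (C := C * √D) (N := N) (Real.sqrt_pos.2 hc0)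
        fun k hk => ?_
      calc ‖x k - xb‖ ≤ C * h k ^ (1 - 1 / 2 : ℝ) := hdist k hk
        _ = C * √(h k) := by rw [Real.sqrt_eq_rpow]; norm_num
        _ ≤ C * √(D * c ^ k) := by gcongr; exact hgeo k hk
        _ = C * √D * √c ^ k := by
          rw [Real.sqrt_mul hD, mul_assoc]
          congr 2
          rw [Real.sqrt_eq_iff_mul_self_eq (by positivity) (by positivity), ← mul_pow,
            Real.mul_self_sqrt hc0.le]
    have hs1 : √c < 1 := by rw [Real.sqrt_lt' one_pos]; simpa using hc1
    refine ⟨C₁ + L * C₁ + L / 2 * C₁ ^ 2, by positivity, √c, ⟨Real.sqrt_pos.2 hc0, hs1⟩,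
      fun k => ?_⟩
    have hpk : 0 < √c ^ k := pow_pos (Real.sqrt_pos.2 hc0) k
    have hpk1 : √c ^ k ≤ 1 := pow_le_one₀ (Real.sqrt_nonneg c) hs1.le
    have e1 := hb k
    have e2 : ‖gradient f (x k)‖ ≤ L * (C₁ * √c ^ k) := (hgrad k).trans (by gcongr)
    have e3 : |f (x k) - f xb| ≤ L / 2 * C₁ ^ 2 * √c ^ k := by
      calc _ ≤ L / 2 * ‖x k - xb‖ ^ 2 := hval k
        _ ≤ L / 2 * (C₁ * √c ^ k) ^ 2 := by gcongr
        _ = L / 2 * C₁ ^ 2 * √c ^ k * √c ^ k := by ring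
        _ ≤ _ := mul_le_of_le_one_right (by positivity) hpk1
    have p1 : 0 < C₁ * √c ^ k := by positivity
    have p2 : 0 < L * C₁ * √c ^ k := by positivity
    have p3 : 0 < L / 2 * C₁ ^ 2 * √c ^ k := by positivity
    refine ⟨?_, ?_, ?_⟩ <;> linarith
  · rw [max_eq_left hq2.le] at hdist hrec
    have ha : 0 < 2 * q - 1 := by linarith
    have h1q : 0 < 1 - q := sub_pos.2 hq.2
    obtain ⟨D, hD, N', hN', hsub⟩ := exists_le_mul_rpow_of_step (a := 2 * q - 1) hs ha hpos
      (fun k hk => by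
        have := hrec k hk
        rwa [show 1 + (2 * q - 1) = 2 * q by ring])
    set C₁ := C * D ^ (1 - q) with hC₁
    have hC₁0 : 0 < C₁ := by positivity
    have hb : ∀ k ≥ N', ‖x k - xb‖ ≤ C₁ * (k : ℝ) ^ (-(1 - q) / (2*q - 1)) := by
      intro k hk
      have h0 := hpos k (by omega)
      calc ‖x k - xb‖ ≤ C * h k ^ (1 - q) := hdist k (by omega)
        _ ≤ C * (D * (k : ℝ) ^ (-(1 / (2 * q - 1)))) ^ (1 - q) := by gcongr; exact hsub k hk
        _ = _ := by
          rw [Real.mul_rpow hD.le (by positivity), ← Real.rpow_mul (Nat.cast_nonneg k), hC₁,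
            mul_assoc]
          congr 3
          field_simp
    refine ⟨C₁ + L * C₁ + L / 2 * C₁ ^ 2, by positivity, N', fun k hk => ?_⟩
    set w := (k : ℝ) ^ (-(1 - q) / (2*q - 1)) with hw
    have hw0 : 0 ≤ w := by positivity
    have hw2 : (k : ℝ) ^ (-(2 - 2*q) / (2*q - 1)) = w ^ 2 := by
      rw [hw, ← Real.rpow_two, ← Real.rpow_mul (Nat.cast_nonneg k)]
      congr 1
      ring
    rw [hw2]
    have e1 := hb k hk
    have e2 : ‖gradient f (x k)‖ ≤ L * (C₁ * w) := (hgrad k).trans (by gcongr)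
    have e3 : f (x k) - f xb ≤ L / 2 * (C₁ * w) ^ 2 :=
      (le_abs_self _).trans ((hval k).trans (by gcongr))
    have p1 : 0 ≤ C₁ * w := by positivity
    have p2 : 0 ≤ L * C₁ * w := by positivity
    have p3 : 0 ≤ L / 2 * C₁ ^ 2 * w := by positivity
    have p4 : 0 ≤ (C₁ + L * C₁) * w ^ 2 := by positivity
    refine ⟨?_, ?_, ?_⟩ <;> linarith
end

section
/- Let x̄ ∈ ℝⁿ be a local minimizer of a function f that is C¹ with L-Lipschitz gradient on the ball B(x̄,r) for some r > 0, and assume f satisfies the PLK condition at x̄. Fix ν ∈ (0,1) and β̄ ∈ [0, √(1−ν)). Then there exist ξ ∈ (0,r] and T > 0 such that for every τ ∈ (0,T], every initial point x⁰ = x¹ ∈ B(x̄,ξ), and every family of IGDm iterates (x^k), (x^k_in), (x^k_ex), (g^k) with X = B(x̄,r) and ∇f(x^k_ex) ≠ 0 for all k, the sequences (x^k), (x^k_in), (x^k_ex) stay in B(x̄,r) and converge to some point x̃ ∈ B(x̄,r) that is a local minimizer of f with f(x̃) = f(x̄). -/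
open Set Filter

/-- Subtracting from a concave function its right limit at `0` gives a function which is
continuous at `0` and still satisfies the tangent inequality. -/
lemma ConcaveOn.exists_shift_tangent_le {η : ℝ} {φ : ℝ → ℝ} (hη : 0 < η)
    (hnn : ∀ t ∈ Ico (0 : ℝ) η, 0 ≤ φ t) (hconc : ConcaveOn ℝ (Ico 0 η) φ)
    (hder : ∀ t ∈ Ioo (0 : ℝ) η, HasDerivAt φ (deriv φ t) t)
    (hpos : ∀ t ∈ Ioo (0 : ℝ) η, 0 < deriv φ t) :
    ∃ ψ : ℝ → ℝ, (∀ t ∈ Ico (0 : ℝ) η, 0 ≤ ψ t) ∧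
      (∀ ε > 0, ∃ δ > 0, ∀ t, 0 ≤ t → t < δ → ψ t < ε) ∧
      ∀ t ∈ Ioo (0 : ℝ) η, ∀ s ∈ Icc 0 t, deriv φ t * (t - s) ≤ ψ t - ψ s := by
  have htan : ∀ t ∈ Ioo (0 : ℝ) η, ∀ s ∈ Ioc 0 t, deriv φ t * (t - s) ≤ φ t - φ s := by
    intro t ht s hs
    rcases hs.2.eq_or_lt with rfl | hst
    · simp
    · have h := hconc.le_slope_of_hasDerivAt ⟨hs.1.le, hst.trans ht.2⟩ ⟨ht.1.le, ht.2⟩ hst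
        (hder t ht)
      rwa [slope_def_field, le_div_iff₀ (by linarith)] at h
  have hne : (φ '' Ioo 0 η).Nonempty := ⟨φ (η / 2), η / 2, ⟨by linarith, by linarith⟩, rfl⟩
  have hbdd : BddBelow (φ '' Ioo 0 η) := by
    refine ⟨0, ?_⟩
    rintro _ ⟨t, ht, rfl⟩
    exact hnn t ⟨ht.1.le, ht.2⟩
  set c := sInf (φ '' Ioo 0 η) with hc
  have hcle : ∀ t ∈ Ioo (0 : ℝ) η, c ≤ φ t := fun t ht => csInf_le hbdd ⟨t, ht, rfl⟩
  refine ⟨fun t => if t ≤ 0 then 0 else φ t - c, ?_, ?_, ?_⟩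
  · intro t ht
    by_cases h : t ≤ 0
    · simp [h]
    · simpa [h] using hcle t ⟨not_le.mp h, ht.2⟩
  · intro ε hε
    obtain ⟨_, ⟨t₀, ht₀, rfl⟩, hlt⟩ := exists_lt_of_csInf_lt hne (show c < c + ε by linarith)
    refine ⟨t₀, ht₀.1, fun t ht htt => ?_⟩
    by_cases h : t ≤ 0
    · simpa [h] using hε
    · have h1 := htan t₀ ht₀ t ⟨not_le.mp h, htt.le⟩
      have h2 := mul_nonneg (hpos t₀ ht₀).le (sub_nonneg.2 htt.le)
      simp only [h, if_false]
      linarith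
  · intro t ht s hs
    have htp : ¬ t ≤ 0 := not_le.2 ht.1
    by_cases h : s ≤ 0
    · have hs0 : s = 0 := le_antisymm h hs.1
      subst hs0
      simp only [htp, if_false, le_refl, if_true, sub_zero]
      have hlim : Tendsto (fun s => deriv φ t * (t - s)) (nhdsWithin 0 (Ioi 0))
          (nhds (deriv φ t * t)) := by
        have : Continuous fun s => deriv φ t * (t - s) := by fun_prop
        simpa using (this.tendsto 0).mono_left nhdsWithin_le_nhds
      refine le_of_tendsto hlim ?_
      filter_upwards [Ioo_mem_nhdsGT ht.1] with s hs
      have h1 := htan t ht s ⟨hs.1, hs.2.le⟩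
      have h2 := hcle s ⟨hs.1, hs.2.trans ht.2⟩
      linarith
    · simp only [htp, h, if_false]
      have h1 := htan t ht s ⟨not_le.mp h, hs.2⟩
      linarith

/-- Under the PLK condition the desingularizing function may be chosen continuous at `0`, with
derivative at least `1 / √t`, and such that the PLK inequality still holds when the function gap
is replaced by an upper bound `t` of at most twice the gap. -/
lemma PLKCondition.exists_desingularizing {n : ℕ} {f : EuclideanSpace ℝ (Fin n) → ℝ}
    {x₀ : EuclideanSpace ℝ (Fin n)} (h : PLKCondition f x₀) :
    ∃ (η : ℝ) (U : Set (EuclideanSpace ℝ (Fin n))) (Φ D : ℝ → ℝ), 0 < η ∧ U ∈ nhds x₀ ∧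
      (∀ t ∈ Ico (0 : ℝ) η, 0 ≤ Φ t) ∧
      (∀ ε > 0, ∃ δ > 0, ∀ t, 0 ≤ t → t < δ → Φ t < ε) ∧
      (∀ t ∈ Ioo (0 : ℝ) η, ∀ s ∈ Icc 0 t, D t * (t - s) ≤ Φ t - Φ s) ∧
      (∀ t ∈ Ioo (0 : ℝ) η, 1 / √t ≤ D t) ∧
      ∀ x ∈ U, ∀ t ∈ Ioo (0 : ℝ) η, f x - f x₀ ≤ t → t ≤ 2 * (f x - f x₀) →
        1 ≤ D t * ‖gradient f x‖ := by
  obtain ⟨η, U, φ, hη, hU, -, hnn, hconc, hder, -, hpos, hineq⟩ := h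
  obtain ⟨ψ, hψ, hψε, htan⟩ := hconc.exists_shift_tangent_le hη hnn hder hpos
  have half : ∀ t ∈ Ioo (0 : ℝ) η, t / 2 ∈ Ioo (0 : ℝ) η := fun t ht =>
    ⟨by linarith [ht.1], by linarith [ht.1, ht.2]⟩
  refine ⟨η, U, fun t => 2 * ψ (t / 2) + 2 * √t, fun t => deriv φ (t / 2) + 1 / √t, hη, hU,
    ?_, ?_, ?_, ?_, ?_⟩
  · intro t ht
    have := hψ (t / 2) ⟨by linarith [ht.1], by linarith [ht.1, ht.2]⟩
    positivity
  · intro ε hε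
    obtain ⟨δ, hδ, h⟩ := hψε (ε / 4) (by positivity)
    refine ⟨min (2 * δ) ((ε / 4) ^ 2), by positivity, fun t ht htt => ?_⟩
    have h1 := h (t / 2) (by linarith) (by linarith [htt.trans_le (min_le_left _ _)])
    have h2 : √t < ε / 4 :=
      (Real.sqrt_lt' (by positivity)).2 (htt.trans_le (min_le_right _ _))
    simp only
    linarith
  · intro t ht s hs
    have h1 := htan (t / 2) (half t ht) (s / 2) ⟨by linarith [hs.1], by linarith [hs.2]⟩
    have hst : 0 < √t := Real.sqrt_pos.2 ht.1
    have h2 : 1 / √t * (t - s) ≤ 2 * √t - 2 * √s := by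
      rw [one_div_mul_eq_div, div_le_iff₀ hst]
      nlinarith [Real.sq_sqrt ht.1.le, Real.sq_sqrt hs.1, sq_nonneg (√t - √s)]
    linarith
  · intro t ht
    have := hpos (t / 2) (half t ht)
    linarith
  · intro x hx t ht hle hge
    have hmem : f x - f x₀ ∈ Ioo (0 : ℝ) η := ⟨by linarith [ht.1], by linarith [ht.2]⟩
    have hmono : deriv φ (f x - f x₀) ≤ deriv φ (t / 2) := by
      rcases (show t / 2 ≤ f x - f x₀ by linarith).eq_or_lt with he | hlt
      · rw [he]
      · have m1 : t / 2 ∈ Ico (0 : ℝ) η := Ioo_subset_Ico_self (half t ht)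
        have m2 : f x - f x₀ ∈ Ico (0 : ℝ) η := Ioo_subset_Ico_self hmem
        exact (hconc.le_slope_of_hasDerivAt m1 m2 hlt (hder _ hmem)).trans
          (hconc.slope_le_of_hasDerivAt m1 m2 hlt (hder _ (half t ht)))
    have h1 := hineq x hx (by linarith [hmem.1]) (by linarith [hmem.2])
    have h2 : 0 ≤ 1 / √t := by positivity
    refine h1.trans (mul_le_mul_of_nonneg_right ?_ (norm_nonneg _))
    linarith

/-- The descent lemma on a convex set. -/
lemma descent_of_gradient_lipschitzOn {F : Type*} [NormedAddCommGroup F] [InnerProductSpace ℝ F]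
    [CompleteSpace F] {f : F → ℝ} {s : Set F} (hs : Convex ℝ s) {L : ℝ}
    (hdiff : ∀ x ∈ s, DifferentiableAt ℝ f x)
    (hlip : ∀ x ∈ s, ∀ y ∈ s, ‖gradient f x - gradient f y‖ ≤ L * ‖x - y‖)
    {x y : F} (hx : x ∈ s) (hy : y ∈ s) :
    f y ≤ f x + inner ℝ (gradient f x) (y - x) + L / 2 * ‖y - x‖ ^ 2 := by
  have hmem : ∀ t ∈ Icc (0 : ℝ) 1, x + t • (y - x) ∈ s := fun t ht =>
    hs.add_smul_sub_mem hx hy ht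
  set v := y - x with hv
  have hder : ∀ t ∈ Icc (0 : ℝ) 1, HasDerivAt
      (fun t : ℝ => f (x + t • v) - t * inner ℝ (gradient f x) v - L / 2 * ‖v‖ ^ 2 * t ^ 2)
      (inner ℝ (gradient f (x + t • v)) v - inner ℝ (gradient f x) v
        - L / 2 * ‖v‖ ^ 2 * (2 * t)) t := by
    intro t ht
    have h1 : HasDerivAt (fun t : ℝ => x + t • v) v t := by
      simpa using ((hasDerivAt_id t).smul_const v).const_add x
    have h2 := ((hdiff _ (hmem t ht)).hasGradientAt.hasFDerivAt).comp_hasDerivAt t h1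
    have h3 := (hasDerivAt_id t).mul_const (inner ℝ (gradient f x) v)
    have h4 := ((hasDerivAt_id t).pow 2).const_mul (L / 2 * ‖v‖ ^ 2)
    refine HasDerivAt.congr_deriv ((h2.sub h3).sub h4) ?_
    simp
  have hanti : AntitoneOn
      (fun t : ℝ => f (x + t • v) - t * inner ℝ (gradient f x) v - L / 2 * ‖v‖ ^ 2 * t ^ 2)
      (Icc 0 1) := by
    refine antitoneOn_of_deriv_nonpos (convex_Icc 0 1)
      (fun t ht => (hder t ht).continuousAt.continuousWithinAt)
      (fun t ht => (hder t (interior_subset ht)).differentiableAt.differentiableWithinAt) ?_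
    intro t ht
    have ht' : t ∈ Icc (0 : ℝ) 1 := interior_subset ht
    rw [(hder t ht').deriv, ← inner_sub_left]
    have h1 := real_inner_le_norm (gradient f (x + t • v) - gradient f x) v
    have h2 := hlip _ (hmem t ht') _ hx
    rw [add_sub_cancel_left, norm_smul, Real.norm_of_nonneg ht'.1] at h2
    have h3 := mul_le_mul_of_nonneg_right h2 (norm_nonneg v)
    nlinarith
  have h := hanti (left_mem_Icc.2 zero_le_one) (right_mem_Icc.2 zero_le_one) zero_le_one
  simp only [one_smul, zero_smul, add_zero] at h
  rw [show x + v = y by simp [hv]] at h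
  linarith

/-- Energy estimate for an inertial displacement `d' = b d - τ g` whose direction `g`
approximates `G` with relative error `ν`. -/
lemma inertial_inner_le {F : Type*} [NormedAddCommGroup F] [InnerProductSpace ℝ F]
    {d d' g G G₀ : F} {b ν τ K : ℝ} (hν : 0 ≤ ν) (hν1 : ν ≤ 1) (hτ : 0 ≤ τ)
    (hd' : d' = b • d - τ • g)
    (hg : ‖g - G‖ ≤ ν * ‖g‖) (hG : ‖G₀ - G‖ ≤ K * ‖d‖) :
    τ * inner ℝ G₀ d' ≤
      b ^ 2 / 2 * ‖d‖ ^ 2 - (1 - ν) / 2 * ‖d'‖ ^ 2 + τ * K * ‖d‖ * ‖d'‖ := by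
  have hτg : τ • g = b • d - d' := by rw [hd']; abel
  have e1 : τ * inner ℝ G₀ d' =
      inner ℝ (τ • g) d' + τ * inner ℝ (G₀ - G) d' + τ * inner ℝ (G - g) d' := by
    simp only [inner_sub_left, real_inner_smul_left]; ring
  have e2 : inner ℝ (τ • g) d' = b * inner ℝ d d' - ‖d'‖ ^ 2 := by
    rw [hτg, inner_sub_left, real_inner_smul_left, real_inner_self_eq_norm_sq]
  have e3 : ‖τ • g‖ ^ 2 = b ^ 2 * ‖d‖ ^ 2 - 2 * (b * inner ℝ d d') + ‖d'‖ ^ 2 := by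
    rw [hτg, norm_sub_sq_real, norm_smul, mul_pow, Real.norm_eq_abs, sq_abs,
      real_inner_smul_left]
  have i1 : τ * inner ℝ (G₀ - G) d' ≤ τ * K * ‖d‖ * ‖d'‖ := by
    have h := (real_inner_le_norm (G₀ - G) d').trans
      (mul_le_mul_of_nonneg_right hG (norm_nonneg _))
    nlinarith [mul_le_mul_of_nonneg_left h hτ]
  have i2 : τ * inner ℝ (G - g) d' ≤ ν / 2 * (‖τ • g‖ ^ 2 + ‖d'‖ ^ 2) := by
    rw [norm_sub_rev] at hg
    have h := (real_inner_le_norm (G - g) d').trans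
      (mul_le_mul_of_nonneg_right hg (norm_nonneg _))
    have h' := mul_le_mul_of_nonneg_left h hτ
    rw [norm_smul, Real.norm_of_nonneg hτ]
    nlinarith [mul_nonneg hν (sq_nonneg (τ * ‖g‖ - ‖d'‖))]
  have i3 : 2 * (b * inner ℝ d d') ≤ b ^ 2 * ‖d‖ ^ 2 + ‖d'‖ ^ 2 := by
    have h := norm_sub_sq_real (b • d) d'
    rw [norm_smul, mul_pow, Real.norm_eq_abs, sq_abs, real_inner_smul_left] at h
    nlinarith [sq_nonneg ‖b • d - d'‖]
  rw [e3] at i2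
  nlinarith [mul_le_mul_of_nonneg_left i3 (sub_nonneg.2 hν1)]

/-- One step of the inexact inertial method near a local minimizer: all points stay in the
reference ball, a Lyapunov function decreases, and the gradient is controlled by the sum of two
consecutive displacements. -/
lemma inertial_step {F : Type*} [NormedAddCommGroup F] [InnerProductSpace ℝ F]
    [CompleteSpace F] {f : F → ℝ} {xb : F} {ρ L : ℝ}
    (hdiff : ∀ x ∈ Metric.ball xb ρ, DifferentiableAt ℝ f x) (hL : 0 < L)
    (hlip : ∀ x ∈ Metric.ball xb ρ, ∀ y ∈ Metric.ball xb ρ,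
      ‖gradient f x - gradient f y‖ ≤ L * ‖x - y‖)
    (hcrit : gradient f xb = 0)
    {ν βbar Γ τ b c R : ℝ} (hν : 0 ≤ ν) (hν1 : ν < 1) (hb : 0 ≤ b) (hbβ : b ≤ βbar)
    (hκ : 0 < 1 - ν - βbar ^ 2) (hc : 0 ≤ c) (hcΓ : c ≤ Γ) (hτ : 0 < τ)
    (hτL : τ * (L * (Γ + 1)) ≤ (1 - ν - βbar ^ 2) / 4) (hR : (3 + Γ) * R < ρ)
    {x d g : F} (hx : ‖x - xb‖ ≤ R) (hd : ‖d‖ ≤ R)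
    (hg : ‖g - gradient f (x + c • d)‖ ≤ ν * ‖g‖) {d' : F} (hd' : d' = b • d - τ • g) :
    x + b • d ∈ Metric.ball xb ρ ∧ x + c • d ∈ Metric.ball xb ρ ∧ x + d' ∈ Metric.ball xb ρ ∧
    τ * (f (x + d') - f x) ≤ (βbar ^ 2 + (1 - ν - βbar ^ 2) / 2) / 2 * (‖d‖ ^ 2 - ‖d'‖ ^ 2) -
      (1 - ν - βbar ^ 2) / 8 * (‖d‖ ^ 2 + ‖d'‖ ^ 2) ∧
    τ * ‖gradient f x‖ ≤ 3 * (‖d‖ + ‖d'‖) := by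
  set κ := 1 - ν - βbar ^ 2 with hκdef
  have hR0 : 0 ≤ R := (norm_nonneg _).trans hd
  have hΓ : 0 ≤ Γ := hc.trans hcΓ
  have hΓR : 0 ≤ Γ * R := mul_nonneg hΓ hR0
  have hρ : 0 < ρ := by nlinarith
  have hb1 : b ≤ 1 := by nlinarith
  have hxb : xb ∈ Metric.ball xb ρ := Metric.mem_ball_self hρ
  have hxm : x ∈ Metric.ball xb ρ := by
    rw [mem_ball_iff_norm]; nlinarith
  have hbd : ‖b • d‖ ≤ ‖d‖ := by
    rw [norm_smul, Real.norm_of_nonneg hb]; nlinarith [norm_nonneg d]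
  have hcd : ‖c • d‖ ≤ Γ * ‖d‖ := by
    rw [norm_smul, Real.norm_of_nonneg hc]; gcongr
  have hin : ‖x + b • d - xb‖ ≤ 2 * R := by
    rw [add_sub_right_comm]; linarith [norm_add_le (x - xb) (b • d)]
  have hex : ‖x + c • d - xb‖ ≤ (1 + Γ) * R := by
    rw [add_sub_right_comm]
    nlinarith [norm_add_le (x - xb) (c • d), mul_le_mul_of_nonneg_left hd hΓ]
  have hinm : x + b • d ∈ Metric.ball xb ρ := by
    rw [mem_ball_iff_norm]; linarith
  have hexm : x + c • d ∈ Metric.ball xb ρ := by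
    rw [mem_ball_iff_norm]; linarith
  have hκν : κ ≤ 1 - ν := by nlinarith [sq_nonneg βbar]
  have hgrad : ‖gradient f (x + c • d)‖ ≤ L * ((1 + Γ) * R) := by
    have h := hlip _ hexm _ hxb
    rw [hcrit, sub_zero] at h
    exact h.trans (by gcongr)
  have hτg : τ * ‖g‖ ≤ R := by
    have h1 : ‖g‖ ≤ ‖g - gradient f (x + c • d)‖ + ‖gradient f (x + c • d)‖ :=
      norm_le_norm_sub_add _ _
    have h2 : (1 - ν) * ‖g‖ ≤ L * ((1 + Γ) * R) := by linarith
    have h3 : (1 - ν) * (τ * ‖g‖) ≤ (1 - ν) * R := by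
      calc (1 - ν) * (τ * ‖g‖) = τ * ((1 - ν) * ‖g‖) := by ring
        _ ≤ τ * (L * ((1 + Γ) * R)) := by gcongr
        _ = τ * (L * (Γ + 1)) * R := by ring
        _ ≤ (1 - ν) * R := by gcongr; linarith
    exact le_of_mul_le_mul_left h3 (by linarith)
  have hnextm : x + d' ∈ Metric.ball xb ρ := by
    rw [mem_ball_iff_norm, hd', show x + (b • d - τ • g) - xb = (x + b • d - xb) - τ • g by abel]
    have h := norm_sub_le (x + b • d - xb) (τ • g)
    rw [norm_smul, Real.norm_of_nonneg hτ.le] at h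
    linarith
  have hG : ‖gradient f x - gradient f (x + c • d)‖ ≤ L * Γ * ‖d‖ := by
    refine (hlip _ hxm _ hexm).trans ?_
    rw [sub_add_cancel_left, norm_neg, mul_assoc]
    gcongr
  have hLΓ : τ * (L * Γ) ≤ κ / 4 - τ * L := by linarith
  have hτL0 : 0 < τ * L := by positivity
  have hτLΓ0 : 0 ≤ τ * (L * Γ) := by positivity
  refine ⟨hinm, hexm, hnextm, ?_, ?_⟩
  · have h1 := descent_of_gradient_lipschitzOn (convex_ball xb ρ) hdiff hlip hxm hnextm
    rw [add_sub_cancel_left] at h1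
    have h2 := inertial_inner_le hν hν1.le hτ.le hd' hg hG
    have h3 := mul_le_mul_of_nonneg_left h1 hτ.le
    have h4 : b ^ 2 ≤ βbar ^ 2 := by gcongr
    have h5 := mul_le_mul_of_nonneg_right h4 (sq_nonneg ‖d‖)
    have h6 : τ * (L * Γ) * (2 * (‖d‖ * ‖d'‖)) ≤ τ * (L * Γ) * (‖d‖ ^ 2 + ‖d'‖ ^ 2) := by
      gcongr
      nlinarith [sq_nonneg (‖d‖ - ‖d'‖)]
    have h7 := mul_le_mul_of_nonneg_right hLΓ (add_nonneg (sq_nonneg ‖d‖) (sq_nonneg ‖d'‖))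
    have h8 := mul_nonneg hτL0.le (sq_nonneg ‖d‖)
    have h9 : κ * ‖d'‖ ^ 2 = (1 - ν - βbar ^ 2) * ‖d'‖ ^ 2 := rfl
    linarith
  · have h1 : ‖gradient f x‖ ≤
        ‖gradient f x - gradient f (x + c • d)‖ + ‖gradient f (x + c • d)‖ :=
      norm_le_norm_sub_add _ _
    have h2 : ‖gradient f (x + c • d)‖ ≤ ‖gradient f (x + c • d) - g‖ + ‖g‖ :=
      norm_le_norm_sub_add _ _
    rw [norm_sub_rev] at h2
    have h3 : ‖gradient f x‖ ≤ L * Γ * ‖d‖ + 2 * ‖g‖ := by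
      nlinarith [norm_nonneg g]
    have h4 : τ * ‖g‖ ≤ ‖d‖ + ‖d'‖ := by
      have h := norm_sub_le (b • d) d'
      rw [show b • d - d' = τ • g by rw [hd']; abel, norm_smul, Real.norm_of_nonneg hτ.le] at h
      linarith
    have h5 := mul_le_mul_of_nonneg_left h3 hτ.le
    have h6 : τ * (L * Γ) * ‖d‖ ≤ 1 * ‖d‖ := by
      gcongr
      linarith
    linarith [norm_nonneg d']

/-- A quadratic decrease of `V` together with a Łojasiewicz-type bound on the tangent slope `D`
gives a linear decrease of the desingularized values. -/
lemma le_sub_of_tangent {η κ τ s V V' : ℝ} {Φ D : ℝ → ℝ}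
    (htan : ∀ t ∈ Ioo (0 : ℝ) η, ∀ s ∈ Icc 0 t, D t * (t - s) ≤ Φ t - Φ s)
    (hκ : 0 < κ) (hτ : 0 < τ) (hs : 0 ≤ s) (hV : 0 ≤ V) (hVη : V < η) (hV' : 0 ≤ V')
    (hdec : κ / 16 * s ^ 2 ≤ τ * (V - V')) (hD : 0 < V → 0 ≤ D V ∧ τ ≤ D V * (3 * s)) :
    2 * s ≤ 96 / κ * (Φ V - Φ V') := by
  have hle : V' ≤ V := by
    have h : 0 ≤ τ * (V - V') := le_trans (by positivity) hdec
    linarith [nonneg_of_mul_nonneg_right h hτ]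
  rcases hV.eq_or_lt with h0 | h0
  · have hVV : V' = V := by linarith
    have hs0 : s = 0 := by
      rw [hVV, sub_self, mul_zero] at hdec
      have h : s ^ 2 ≤ 0 := nonpos_of_mul_nonpos_right hdec (by positivity)
      exact pow_eq_zero_iff two_ne_zero |>.1 (le_antisymm h (sq_nonneg s))
    simp [hVV, hs0]
  · obtain ⟨hD0, hDs⟩ := hD h0
    have h1 := htan V ⟨h0, hVη⟩ V' ⟨hV', hle⟩
    have h2 := mul_le_mul_of_nonneg_left hdec hD0
    have h3 := mul_le_mul_of_nonneg_right hDs (show 0 ≤ κ * s / 48 by positivity)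
    have h4 : τ * (κ * s / 48) ≤ τ * (D V * (V - V')) := by linarith
    have h5 := (le_of_mul_le_mul_left h4 hτ).trans h1
    rw [div_mul_eq_mul_div, le_div_iff₀ hκ]
    linarith

/-- If the kinetic energy makes up half of `V`, then `√V` is controlled by the displacement. -/
lemma mul_sqrt_le_of_le_kinetic {m τ V a : ℝ} (hm1 : m ≤ 1) (hτ : 0 < τ)
    (hτ1 : τ ≤ 1) (hV : 0 ≤ V) (ha : 0 ≤ a) (h : V ≤ 2 * (m / (2 * τ) * a ^ 2)) :
    τ * √V ≤ a := by
  refine le_of_sq_le_sq ?_ ha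
  rw [mul_pow, Real.sq_sqrt hV]
  calc τ ^ 2 * V ≤ τ ^ 2 * (2 * (m / (2 * τ) * a ^ 2)) := by gcongr
    _ = m * τ * a ^ 2 := by field_simp
    _ ≤ 1 * 1 * a ^ 2 := by gcongr
    _ = a ^ 2 := by ring

/-- Bounded extrapolation along vanishing displacements does not change the limit. -/
lemma tendsto_extrapolation {E : Type*} [NormedAddCommGroup E] [NormedSpace ℝ E]
    {x y d : ℕ → E} {c : ℕ → ℝ} {C : ℝ} {a : E} (hx : Tendsto x atTop (nhds a))
    (hd : Tendsto (fun k => ‖d k‖) atTop (nhds 0)) (hc : ∀ k, 0 ≤ c k) (hcC : ∀ k, c k ≤ C)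
    (hy : ∀ k, 1 ≤ k → y k = x k + c k • d k) : Tendsto y atTop (nhds a) := by
  have h0 : Tendsto (fun k => c k • d k) atTop (nhds 0) := by
    refine squeeze_zero_norm (a := fun k => C * ‖d k‖) (fun k => ?_) ?_
    · rw [norm_smul, Real.norm_of_nonneg (hc k)]
      exact mul_le_mul_of_nonneg_right (hcC k) (norm_nonneg _)
    · simpa using hd.const_mul C
  have h1 : Tendsto (fun k => x k + c k • d k) atTop (nhds a) := by
    simpa using hx.add h0
  refine h1.congr' ?_
  filter_upwards [eventually_ge_atTop 1] with k hk using (hy k hk).symm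

set_option maxHeartbeats 1000000 in
/-- Local convergence of IGDm around a local minimizer `xb` of `f` satisfying the PLK
condition: for sufficiently small stepsizes `τ` and starting points near `xb`, the IGDm
iterates stay in `B(xb, r)` and converge to a local minimizer `xt` of `f` with
`f xt = f xb`. -/
theorem IGDm_local_convergence_PLK {n : ℕ}
    (f : EuclideanSpace ℝ (Fin n) → ℝ)
    (r : ℝ) (hr : 0 < r)
    (xb : EuclideanSpace ℝ (Fin n))
    (hdiff : ∀ x ∈ Metric.ball xb r, DifferentiableAt ℝ f x)
    (L : ℝ) (hL : 0 < L)
    (hlip : ∀ x ∈ Metric.ball xb r, ∀ y ∈ Metric.ball xb r,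
      ‖gradient f x - gradient f y‖ ≤ L * ‖x - y‖)
    (hmin : IsLocalMin f xb)
    (hPLK : PLKCondition f xb)
    (ν βbar δbar : ℝ) (hν : ν ∈ Set.Ioo (0:ℝ) 1)
    (hβbar : 0 ≤ βbar) (hβbar' : βbar < Real.sqrt (1 - ν))
    (β γ : ℕ → ℝ) (hβnn : ∀ k, 0 ≤ β k) (hγnn : ∀ k, 0 ≤ γ k)
    (hβb : ∀ k, β k ≤ βbar) (hδb : ∀ k, |β k - γ k| ≤ δbar) :
    ∃ ξ T : ℝ, 0 < ξ ∧ ξ ≤ r ∧ 0 < T ∧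
      ∀ τ : ℝ, 0 < τ → τ ≤ T →
      ∀ x xin xex g : ℕ → EuclideanSpace ℝ (Fin n),
        x 0 = x 1 → x 1 ∈ Metric.ball xb ξ →
        (∀ k, 1 ≤ k → xin k = x k + β k • (x k - x (k-1))) →
        (∀ k, 1 ≤ k → xex k = x k + γ k • (x k - x (k-1))) →
        (∀ k, 1 ≤ k → x (k+1) = xin k - τ • g k) →
        (∀ k, 1 ≤ k → ‖g k - gradient f (xex k)‖ ≤ ν * ‖g k‖) →
        (∀ k, 1 ≤ k → gradient f (xex k) ≠ 0) →
        (∀ k, 1 ≤ k → x k ∈ Metric.ball xb r ∧ xin k ∈ Metric.ball xb r ∧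
          xex k ∈ Metric.ball xb r) ∧
        ∃ xt ∈ Metric.ball xb r,
          IsLocalMin f xt ∧ f xt = f xb ∧
          Tendsto x atTop (nhds xt) ∧
          Tendsto xin atTop (nhds xt) ∧
          Tendsto xex atTop (nhds xt) := by
  obtain ⟨η, U, Φ, D, hη, hU, hΦ0, hΦε, htan, hDlow, hDgrad⟩ := hPLK.exists_desingularizing
  set Γ := βbar + δbar with hΓdef
  set κ := 1 - ν - βbar ^ 2 with hκdef
  have hδ0 : 0 ≤ δbar := (abs_nonneg _).trans (hδb 0)
  have hΓ0 : 0 ≤ Γ := by positivity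
  have hκ : 0 < κ := by
    have := (Real.lt_sqrt hβbar).1 hβbar'
    linarith
  have hκ1 : κ ≤ 1 := by
    have := hν.1
    nlinarith [sq_nonneg βbar]
  have hγΓ : ∀ k, γ k ≤ Γ := fun k => by
    linarith [hβb k, neg_abs_le (β k - γ k), hδb k]
  have hcrit : gradient f xb = 0 := by
    rw [gradient, hmin.fderiv_eq_zero, map_zero]
  obtain ⟨ρ, hρ, hρsub⟩ := Metric.mem_nhds_iff.1
    (inter_mem (inter_mem hU hmin) (Metric.ball_mem_nhds xb hr))
  have hρU : ∀ x ∈ Metric.ball xb ρ, x ∈ U := fun x hx => (hρsub hx).1.1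
  have hρmin : ∀ x ∈ Metric.ball xb ρ, f xb ≤ f x := fun x hx => (hρsub hx).1.2
  have hρr : Metric.ball xb ρ ⊆ Metric.ball xb r := fun x hx => (hρsub hx).2
  have hdiffρ : ∀ x ∈ Metric.ball xb ρ, DifferentiableAt ℝ f x := fun x hx => hdiff x (hρr hx)
  have hlipρ : ∀ x ∈ Metric.ball xb ρ, ∀ y ∈ Metric.ball xb ρ,
      ‖gradient f x - gradient f y‖ ≤ L * ‖x - y‖ := fun x hx y hy =>
    hlip x (hρr hx) y (hρr hy)
  set A := 96 / κ with hA
  have hA0 : 0 < A := by positivity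
  obtain ⟨δ, hδ, hΦδ⟩ := hΦε (ρ / (2 * (3 + Γ)) / A) (by positivity)
  have hcont : ContinuousAt f xb := (hdiff xb (Metric.mem_ball_self hr)).continuousAt
  obtain ⟨ξ₁, hξ₁, hξsub⟩ := Metric.mem_nhds_iff.1
    (hcont.eventually (gt_mem_nhds (show f xb < f xb + min η δ by
      have : 0 < min η δ := lt_min hη hδ
      linarith)))
  refine ⟨min r (min ξ₁ (ρ / (2 * (3 + Γ)))), min 1 (κ / (4 * (L * (Γ + 1)))), by positivity,
    min_le_left _ _, by positivity, ?_⟩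
  intro τ hτ hτT x xin xex g hx01 hx1 hxin hxex hxs hg _
  have hτ1 : τ ≤ 1 := hτT.trans (min_le_left _ _)
  have hτL : τ * (L * (Γ + 1)) ≤ κ / 4 := by
    have h := hτT.trans (min_le_right _ _)
    rw [le_div_iff₀ (by positivity)] at h
    linarith
  set m := βbar ^ 2 + κ / 2 with hm
  have hm0 : 0 < m := by positivity
  have hm1 : m ≤ 1 := by
    have := hν.1
    linarith
  set d : ℕ → EuclideanSpace ℝ (Fin n) := fun k => x k - x (k - 1) with hd
  set V : ℕ → ℝ := fun k => f (x k) - f xb + m / (2 * τ) * ‖d k‖ ^ 2 with hV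
  have hd1 : d 1 = 0 := by simp [hd, hx01]
  have hV1 : V 1 = f (x 1) - f xb := by simp [hV, hd1]
  have hx1' : ‖x 1 - xb‖ < min r (min ξ₁ (ρ / (2 * (3 + Γ)))) := mem_ball_iff_norm.1 hx1
  have hx1ξ : ‖x 1 - xb‖ < ξ₁ := hx1'.trans_le ((min_le_right _ _).trans (min_le_left _ _))
  have hx1ρ : ‖x 1 - xb‖ < ρ / (2 * (3 + Γ)) :=
    hx1'.trans_le ((min_le_right _ _).trans (min_le_right _ _))
  have hV1lt : V 1 < min η δ := by
    have : f (x 1) < f xb + min η δ := hξsub (mem_ball_iff_norm.2 hx1ξ)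
    rw [hV1]; linarith
  have hV1nn : 0 ≤ V 1 := by
    rw [hV1, sub_nonneg]
    refine hρmin _ (mem_ball_iff_norm.2 (hx1ρ.trans_le ?_))
    exact div_le_self hρ.le (by linarith)
  set R := ‖x 1 - xb‖ + A * Φ (V 1) with hRdef
  have hR : (3 + Γ) * R < ρ := by
    have h1 := hΦδ _ hV1nn (hV1lt.trans_le (min_le_right _ _))
    rw [lt_div_iff₀ hA0] at h1
    have h2 : R < ρ / (2 * (3 + Γ)) + ρ / (2 * (3 + Γ)) := by linarith
    calc (3 + Γ) * R < (3 + Γ) * (ρ / (2 * (3 + Γ)) + ρ / (2 * (3 + Γ))) := by gcongr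
      _ = ρ := by field_simp; ring
  have hstep : ∀ k, 1 ≤ k → 0 ≤ V k → V k ≤ V 1 → ‖x k - xb‖ + ‖d k‖ + A * Φ (V k) ≤ R →
      (xin k ∈ Metric.ball xb ρ ∧ xex k ∈ Metric.ball xb ρ ∧
        2 * (‖d k‖ + ‖d (k + 1)‖) ≤ A * (Φ (V k) - Φ (V (k + 1))) ∧
        τ * ‖gradient f (x k)‖ ≤ 3 * (‖d k‖ + ‖d (k + 1)‖)) ∧
      0 ≤ V (k + 1) ∧ V (k + 1) ≤ V 1 ∧
      ‖x (k + 1) - xb‖ + ‖d (k + 1)‖ + A * Φ (V (k + 1)) ≤ R := by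
    intro k hk hVk hVk1 hRk
    have hVη : V k < η := hVk1.trans_lt (hV1lt.trans_le (min_le_left _ _))
    have hAΦ : 0 ≤ A * Φ (V k) := mul_nonneg hA0.le (hΦ0 _ ⟨hVk, hVη⟩)
    have hxR : ‖x k - xb‖ ≤ R := by linarith [norm_nonneg (d k)]
    have hdR : ‖d k‖ ≤ R := by linarith [norm_nonneg (x k - xb)]
    have hgk := hg k hk
    rw [hxex k hk] at hgk
    have hd' : d (k + 1) = β k • d k - τ • g k := by
      simp only [hd, Nat.add_sub_cancel]
      rw [hxs k hk, hxin k hk]; abel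
    have hxd : x k + d (k + 1) = x (k + 1) := by simp [hd]
    obtain ⟨m1, m2, m3, hdec, hgrad⟩ := inertial_step hdiffρ hL hlipρ hcrit hν.1.le hν.2
      (hβnn k) (hβb k) hκ (hγnn k) (hγΓ k) hτ hτL hR hxR hdR hgk hd'
    rw [hxd] at m3 hdec
    have hxρ : x k ∈ Metric.ball xb ρ := by
      rw [mem_ball_iff_norm]
      nlinarith [mul_nonneg hΓ0 ((norm_nonneg _).trans hxR), norm_nonneg (d k)]
    have hVdec : κ / 16 * (‖d k‖ + ‖d (k + 1)‖) ^ 2 ≤ τ * (V k - V (k + 1)) := by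
      have e : τ * (V k - V (k + 1)) =
          m / 2 * (‖d k‖ ^ 2 - ‖d (k + 1)‖ ^ 2) - τ * (f (x (k + 1)) - f (x k)) := by
        simp only [hV]; field_simp; ring
      rw [e]
      nlinarith [mul_nonneg hκ.le (sq_nonneg (‖d k‖ - ‖d (k + 1)‖))]
    have hVnn : 0 ≤ V (k + 1) := by
      have := hρmin _ m3
      have h2 : 0 ≤ m / (2 * τ) * ‖d (k + 1)‖ ^ 2 := by positivity
      simp only [hV]; linarith
    have hVle : V (k + 1) ≤ V k := by
      have h : 0 ≤ τ * (V k - V (k + 1)) := le_trans (by positivity) hVdec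
      linarith [nonneg_of_mul_nonneg_right h hτ]
    have hdes : 2 * (‖d k‖ + ‖d (k + 1)‖) ≤ A * (Φ (V k) - Φ (V (k + 1))) := by
      refine le_sub_of_tangent htan hκ hτ (by positivity) hVk hVη hVnn hVdec fun hVpos => ?_
      have hsq : 0 < √(V k) := Real.sqrt_pos.2 hVpos
      have hlow := hDlow _ ⟨hVpos, hVη⟩
      have hD0 : 0 ≤ D (V k) := le_trans (by positivity) hlow
      refine ⟨hD0, ?_⟩
      have hkin : 0 ≤ m / (2 * τ) * ‖d k‖ ^ 2 := by positivity
      by_cases hcase : V k ≤ 2 * (f (x k) - f xb)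
      · have h1 := hDgrad _ (hρU _ hxρ) _ ⟨hVpos, hVη⟩ (by simp only [hV]; linarith) hcase
        have h2 := mul_le_mul_of_nonneg_left h1 hτ.le
        have h3 := mul_le_mul_of_nonneg_left hgrad hD0
        linarith
      · have h1 : V k ≤ 2 * (m / (2 * τ) * ‖d k‖ ^ 2) := by
          simp only [hV] at hcase ⊢; linarith
        have h2 := mul_sqrt_le_of_le_kinetic hm1 hτ hτ1 hVk (norm_nonneg _) h1
        calc τ = 1 / √(V k) * (τ * √(V k)) := by field_simp
          _ ≤ D (V k) * (3 * (‖d k‖ + ‖d (k + 1)‖)) :=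
            mul_le_mul hlow (by linarith [norm_nonneg (d (k + 1)), norm_nonneg (d k)])
              (by positivity) hD0
    refine ⟨⟨hxin k hk ▸ m1, hxex k hk ▸ m2, hdes, hgrad⟩, hVnn, hVle.trans hVk1, ?_⟩
    have htri : ‖x (k + 1) - xb‖ ≤ ‖x k - xb‖ + ‖d (k + 1)‖ := by
      rw [← hxd, add_sub_right_comm]; exact norm_add_le _ _
    linarith [norm_nonneg (d k)]
  have hinv : ∀ k, 1 ≤ k → 0 ≤ V k ∧ V k ≤ V 1 ∧ ‖x k - xb‖ + ‖d k‖ + A * Φ (V k) ≤ R := by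
    intro k hk
    induction k, hk using Nat.le_induction with
    | base => exact ⟨hV1nn, le_rfl, by simp [hd1, hRdef]⟩
    | succ k hk ih => exact (hstep k hk ih.1 ih.2.1 ih.2.2).2
  have hall : ∀ k, 1 ≤ k → xin k ∈ Metric.ball xb ρ ∧ xex k ∈ Metric.ball xb ρ ∧
      2 * (‖d k‖ + ‖d (k + 1)‖) ≤ A * (Φ (V k) - Φ (V (k + 1))) ∧
      τ * ‖gradient f (x k)‖ ≤ 3 * (‖d k‖ + ‖d (k + 1)‖) := fun k hk =>
    (hstep k hk (hinv k hk).1 (hinv k hk).2.1 (hinv k hk).2.2).1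
  have hΦnn : ∀ k, 1 ≤ k → 0 ≤ A * Φ (V k) := fun k hk =>
    mul_nonneg hA0.le (hΦ0 _ ⟨(hinv k hk).1,
      (hinv k hk).2.1.trans_lt (hV1lt.trans_le (min_le_left _ _))⟩)
  have hxR : ∀ k, 1 ≤ k → ‖x k - xb‖ ≤ R := fun k hk => by
    linarith [(hinv k hk).2.2, hΦnn k hk, norm_nonneg (d k)]
  have hRρ : R < ρ := by
    have hR0 : 0 ≤ R := (norm_nonneg _).trans (hxR 1 le_rfl)
    nlinarith [mul_nonneg hΓ0 hR0]
  have hxρ : ∀ k, 1 ≤ k → x k ∈ Metric.ball xb ρ := fun k hk =>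
    mem_ball_iff_norm.2 ((hxR k hk).trans_lt hRρ)
  have hsum : Summable fun k => ‖d (k + 1)‖ := by
    refine summable_of_sum_range_le (c := A * Φ (V 1)) (fun _ => norm_nonneg _) fun N => ?_
    have h : ∀ N, ∑ k ∈ Finset.range N, ‖d (k + 1)‖ ≤ A * Φ (V 1) - A * Φ (V (N + 1)) := by
      intro N
      induction N with
      | zero => simp
      | succ N ih =>
        rw [Finset.sum_range_succ]
        have := (hall (N + 1) (by lia)).2.2.1
        linarith [norm_nonneg (d (N + 1)), norm_nonneg (d (N + 1 + 1))]
    linarith [h N, hΦnn (N + 1) (by lia)]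
  have hd0 : Tendsto (fun k => ‖d k‖) atTop (nhds 0) :=
    (tendsto_add_atTop_iff_nat 1).1 hsum.tendsto_atTop_zero
  have hcauchy : CauchySeq x := by
    refine cauchySeq_of_summable_dist (hsum.congr fun k => ?_)
    rw [dist_comm, dist_eq_norm]
    simp [hd]
  obtain ⟨xt, hxt⟩ := cauchySeq_tendsto_of_complete hcauchy
  have hxtρ : xt ∈ Metric.ball xb ρ := by
    rw [mem_ball_iff_norm]
    refine lt_of_le_of_lt (le_of_tendsto ((hxt.sub_const xb).norm) ?_) hRρ
    filter_upwards [eventually_ge_atTop 1] with k hk using hxR k hk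
  have hgradxt : gradient f xt = 0 := by
    have h1 : Tendsto (fun k => 3 * (‖d k‖ + ‖d (k + 1)‖) + τ * (L * ‖x k - xt‖)) atTop
        (nhds 0) := by
      have h2 := (hd0.add ((tendsto_add_atTop_iff_nat 1).2 hd0)).const_mul 3
      have h3 := (((hxt.sub_const xt).norm).const_mul L).const_mul τ
      simpa using h2.add h3
    have h2 : τ * ‖gradient f xt‖ ≤ 0 := by
      refine ge_of_tendsto h1 ?_
      filter_upwards [eventually_ge_atTop 1] with k hk
      have h3 := hlipρ _ (hxρ k hk) _ hxtρ
      have h4 : ‖gradient f xt‖ ≤ ‖gradient f xt - gradient f (x k)‖ + ‖gradient f (x k)‖ :=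
        norm_le_norm_sub_add _ _
      rw [norm_sub_rev] at h4
      have h5 := mul_le_mul_of_nonneg_left (h4.trans (add_le_add_left h3 _)) hτ.le
      linarith [(hall k hk).2.2.2]
    exact norm_le_zero_iff.1 (nonpos_of_mul_nonpos_right h2 hτ)
  have hfxt : f xt = f xb := by
    refine le_antisymm (not_lt.1 fun hlt => ?_) (hρmin xt hxtρ)
    have hle : f xt - f xb < η := by
      have hcf : Tendsto (fun k => f (x k)) atTop (nhds (f xt)) :=
        (hdiffρ xt hxtρ).continuousAt.tendsto.comp hxt
      have h : f xt ≤ V 1 + f xb := by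
        refine le_of_tendsto hcf ?_
        filter_upwards [eventually_ge_atTop 1] with k hk
        have h1 := (hinv k hk).2.1
        have h2 : 0 ≤ m / (2 * τ) * ‖d k‖ ^ 2 := by positivity
        have h3 : V k = f (x k) - f xb + m / (2 * τ) * ‖d k‖ ^ 2 := rfl
        linarith
      linarith [hV1lt.trans_le (min_le_left _ _)]
    have h := hDgrad xt (hρU xt hxtρ) (f xt - f xb) ⟨by linarith, hle⟩ le_rfl (by linarith)
    rw [hgradxt, norm_zero, mul_zero] at h
    linarith
  refine ⟨fun k hk => ⟨hρr (hxρ k hk), hρr (hall k hk).1, hρr (hall k hk).2.1⟩,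
    xt, hρr hxtρ, ?_, hfxt, hxt,
    tendsto_extrapolation hxt hd0 hβnn hβb hxin,
    tendsto_extrapolation hxt hd0 hγnn hγΓ hxex⟩
  filter_upwards [Metric.isOpen_ball.mem_nhds hxtρ] with y hy
  rw [hfxt]
  exact hρmin y hy
end

section
/- Let x̄ ∈ ℝⁿ be a local minimizer of a function f that is C¹ with L-Lipschitz gradient on the ball B(x̄,r) for some r > 0, and assume f satisfies the exponential PLK condition at x̄ with exponent q ∈ (0,1) and constant M > 0. Fix ν ∈ (0,1) and β̄ ∈ [0, √(1−ν)). Then there exist ξ ∈ (0,r] and T > 0 such that for every τ ∈ (0,T], every x⁰ = x¹ ∈ B(x̄,ξ), and every family of IGDm iterates with X = B(x̄,r) and ∇f(x^k_ex) ≠ 0 for all k, the sequence (x^k) converges to some local minimizer x̃ of f with f(x̃) = f(x̄), and moreover: (i) if q = 1/2, the sequences (x^k), (∇f(x^k)), (f(x^k)) converge linearly to x̃, 0, f(x̃), respectively; (ii) if q ∈ (1/2,1), there exists C > 0 such that for all large k, ‖x^k − x̃‖ ≤ C·k^{−(1−q)/(2q−1)}, ‖∇f(x^k)‖ ≤ C·k^{−(1−q)/(2q−1)},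 and f(x^k) − f(x̃) ≤ C·k^{−(2−2q)/(2q−1)}. -/
open Set Filter

open scoped Topology

lemma gradient_quadratic_upper_bound {E : Type*} [NormedAddCommGroup E] [InnerProductSpace ℝ E]
    [CompleteSpace E] {f : E → ℝ} {s : Set E} {L : ℝ} (hs : Convex ℝ s)
    (hdiff : ∀ x ∈ s, DifferentiableAt ℝ f x) (hL : 0 ≤ L)
    (hlip : ∀ x ∈ s, ∀ y ∈ s, ‖gradient f x - gradient f y‖ ≤ L * ‖x - y‖)
    {x y : E} (hx : x ∈ s) (hy : y ∈ s) :
    f y ≤ f x + inner ℝ (gradient f x) (y - x) + L * ‖y - x‖ ^ 2 := by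
  have hsub : segment ℝ x y ⊆ s := hs.segment_subset hx hy
  have key := Convex.norm_image_sub_le_of_norm_fderiv_le' (𝕜 := ℝ) (f := f)
    (φ := fderiv ℝ f x) (C := L * ‖y - x‖)
    (fun z hz => hdiff z (hsub hz)) (fun z hz => by
      rw [← toDual_gradient, ← toDual_gradient, ← map_sub, LinearIsometryEquiv.norm_map]
      refine (hlip z (hsub hz) x hx).trans (mul_le_mul_of_nonneg_left ?_ hL)
      obtain ⟨t, ht, rfl⟩ := (segment_eq_image' ℝ x y).subset hz
      simp only [add_sub_cancel_left, norm_smul, Real.norm_eq_abs, abs_of_nonneg ht.1]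
      exact mul_le_of_le_one_left (norm_nonneg _) ht.2)
    (convex_segment x y) (left_mem_segment ℝ x y) (right_mem_segment ℝ x y)
  rw [← inner_gradient_left, Real.norm_eq_abs] at key
  nlinarith [(abs_le.mp key).2]

lemma IsLocalMin.gradient_eq_zero {E : Type*} [NormedAddCommGroup E] [InnerProductSpace ℝ E]
    [CompleteSpace E] {f : E → ℝ} {x : E} (h : IsLocalMin f x) : gradient f x = 0 := by
  simp [gradient, h.fderiv_eq_zero]

lemma inner_inexact_momentum_step_le {E : Type*} [NormedAddCommGroup E] [InnerProductSpace ℝ E]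
    {G G' g d d' : E} {τ β ν b c : ℝ} (hτ : 0 < τ) (hν0 : 0 ≤ ν) (hν1 : ν ≤ 1)
    (hβ0 : 0 ≤ β) (hβ : β ≤ b) (hd : d' = β • d - τ • g) (hg : ‖g - G'‖ ≤ ν * ‖g‖)
    (hG : ‖G - G'‖ ≤ c * ‖d‖) (hc : 0 ≤ c) :
    τ * inner ℝ G d' ≤ -((1 - ν) / 2) * ‖d'‖ ^ 2 + b ^ 2 / 2 * ‖d‖ ^ 2
      + τ * c / 2 * (‖d‖ ^ 2 + ‖d'‖ ^ 2) := by
  have e : τ * inner ℝ G d' =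
      inner ℝ (τ • g) d' + τ * inner ℝ (G' - g) d' + τ * inner ℝ (G - G') d' := by
    simp only [inner_sub_left, real_inner_smul_left]; ring
  have hτg : τ • g = β • d - d' := by rw [hd]; abel
  have h1 : inner ℝ (τ • g) d' = β * inner ℝ d d' - ‖d'‖ ^ 2 := by
    rw [hτg, inner_sub_left, real_inner_smul_left, real_inner_self_eq_norm_sq]
  have h2 : (τ * ‖g‖) ^ 2 = β ^ 2 * ‖d‖ ^ 2 - 2 * (β * inner ℝ d d') + ‖d'‖ ^ 2 := by
    have : τ * ‖g‖ = ‖β • d - d'‖ := by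
      rw [← hτg, norm_smul, Real.norm_eq_abs, abs_of_pos hτ]
    rw [this, norm_sub_sq_real, norm_smul, real_inner_smul_left, mul_pow, Real.norm_eq_abs, sq_abs]
  have h3 : inner ℝ (G' - g) d' ≤ ν * ‖g‖ * ‖d'‖ :=
    (real_inner_le_norm _ _).trans
      (mul_le_mul_of_nonneg_right (by rwa [norm_sub_rev]) (norm_nonneg _))
  have h4 : inner ℝ (G - G') d' ≤ c * ‖d‖ * ‖d'‖ :=
    (real_inner_le_norm _ _).trans (mul_le_mul_of_nonneg_right hG (norm_nonneg _))
  have h5 : τ * inner ℝ (G' - g) d' ≤ ν / 2 * ((τ * ‖g‖) ^ 2 + ‖d'‖ ^ 2) := by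
    have := mul_le_mul_of_nonneg_left h3 hτ.le
    nlinarith [mul_nonneg hν0 (sq_nonneg (τ * ‖g‖ - ‖d'‖))]
  have h6 : τ * inner ℝ (G - G') d' ≤ τ * c / 2 * (‖d‖ ^ 2 + ‖d'‖ ^ 2) := by
    have := mul_le_mul_of_nonneg_left h4 hτ.le
    nlinarith [mul_nonneg (mul_nonneg hτ.le hc) (sq_nonneg (‖d‖ - ‖d'‖))]
  have h7 : 2 * (β * inner ℝ d d') ≤ β ^ 2 * ‖d‖ ^ 2 + ‖d'‖ ^ 2 := by
    nlinarith [sq_nonneg (τ * ‖g‖)]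
  have h8 : β ^ 2 * ‖d‖ ^ 2 ≤ b ^ 2 * ‖d‖ ^ 2 := by gcongr
  rw [h2] at h5
  rw [e, h1]
  nlinarith [mul_le_mul_of_nonneg_left h7 (sub_nonneg.2 hν1)]

lemma mul_sub_le_rpow_mul_rpow_sub_rpow {u v s : ℝ} (hs0 : 0 ≤ s) (hs1 : s ≤ 1)
    (hu : 0 < u) (hv : 0 ≤ v) :
    (1 - s) * (u - v) ≤ u ^ s * (u ^ (1 - s) - v ^ (1 - s)) := by
  have hb := rpow_one_add_le_one_add_mul_self (s := v / u - 1) (by linarith [div_nonneg hv hu.le])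
    (sub_nonneg.2 hs1) (sub_le_self 1 hs0)
  rw [add_sub_cancel, Real.div_rpow hv hu.le, div_le_iff₀ (Real.rpow_pos_of_pos hu _)] at hb
  have hmul : u ^ s * u ^ (1 - s) = u := by
    rw [← Real.rpow_add hu]; simp
  have h := mul_le_mul_of_nonneg_left hb (Real.rpow_nonneg hu.le s)
  have e : u ^ s * ((1 + (1 - s) * (v / u - 1)) * u ^ (1 - s)) = u + (1 - s) * (v - u) := by
    calc _ = (1 + (1 - s) * (v / u - 1)) * (u ^ s * u ^ (1 - s)) := by ring
      _ = _ := by rw [hmul]; field_simp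
  rw [e] at h
  rw [mul_sub (u ^ s), hmul]
  linarith

lemma rpow_sub_rpow_ge_of_sufficient_decrease {u v s a b σ A τ : ℝ} (hs0 : 0 < s) (hs1 : s ≤ 1)
    (hv : 0 ≤ v) (ha : 0 ≤ a) (hb : 0 ≤ b) (hσ : 0 < σ) (hA : 0 < A) (hτ : 0 < τ)
    (hdec : v + σ / τ * (a ^ 2 + b ^ 2) ≤ u) (hKL : u ^ s ≤ A / τ * (a + b)) :
    (1 - s) * σ / (2 * A) * (a + b) ≤ u ^ (1 - s) - v ^ (1 - s) := by
  have hστ : 0 < σ / τ := by positivity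
  have hvu : v ≤ u := by nlinarith [mul_nonneg hστ.le (add_nonneg (sq_nonneg a) (sq_nonneg b))]
  have hmono : v ^ (1 - s) ≤ u ^ (1 - s) := Real.rpow_le_rpow hv hvu (by linarith)
  rcases (add_nonneg ha hb).eq_or_lt with h0 | h0
  · rw [← h0]; simpa using hmono
  have hsq : (a + b) ^ 2 ≤ 2 * (a ^ 2 + b ^ 2) := by nlinarith [sq_nonneg (a - b)]
  have hsqpos : 0 < a ^ 2 + b ^ 2 := by nlinarith
  have hu : 0 < u := by nlinarith [mul_pos hστ hsqpos]
  have h1 := mul_sub_le_rpow_mul_rpow_sub_rpow hs0.le hs1 hu hv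
  have h2 := mul_le_mul_of_nonneg_right hKL (sub_nonneg.2 hmono)
  have h3 : (1 - s) * (σ / τ * (a ^ 2 + b ^ 2)) ≤ (1 - s) * (u - v) :=
    mul_le_mul_of_nonneg_left (by linarith) (by linarith)
  have h4 : (1 - s) * σ / 2 * (a + b) ^ 2 ≤ (1 - s) * σ * (a ^ 2 + b ^ 2) := by
    nlinarith [mul_le_mul_of_nonneg_left hsq (mul_nonneg (sub_nonneg.2 hs1) hσ.le)]
  have h5 : (1 - s) * σ * (a ^ 2 + b ^ 2) ≤ A * (a + b) * (u ^ (1 - s) - v ^ (1 - s)) := by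
    have := mul_le_mul_of_nonneg_left (h3.trans (h1.trans h2)) hτ.le
    calc _ = τ * ((1 - s) * (σ / τ * (a ^ 2 + b ^ 2))) := by field_simp
      _ ≤ _ := this
      _ = _ := by field_simp
  have h6 : (1 - s) * σ / 2 * (a + b) ≤ A * (u ^ (1 - s) - v ^ (1 - s)) := by
    refine le_of_mul_le_mul_right ?_ h0
    nlinarith
  rw [div_mul_eq_mul_div, div_le_iff₀ (by positivity)]
  linarith

lemma exists_tendsto_of_norm_sub_le_sub {E : Type*} [NormedAddCommGroup E] [CompleteSpace E]
    {y : ℕ → E} {ψ : ℕ → ℝ} {c : ℝ} (hc : 0 < c) (hψ : ∀ k, 0 ≤ ψ k)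
    (h : ∀ k, c * ‖y (k + 1) - y k‖ ≤ ψ k - ψ (k + 1)) :
    ∃ a, Tendsto y atTop (𝓝 a) ∧ ∀ k, c * ‖y k - a‖ ≤ ψ k := by
  have hsum : ∀ n, ∑ i ∈ Finset.range n, c * ‖y (i + 1) - y i‖ ≤ ψ 0 := fun n =>
    (Finset.sum_le_sum fun i _ => h i).trans
      (by rw [Finset.sum_range_sub']; linarith [hψ n])
  have hS : Summable fun i => c * ‖y (i + 1) - y i‖ :=
    summable_of_sum_range_le (fun i => by positivity) hsum
  have hC : CauchySeq y := cauchySeq_of_summable_dist <| by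
    have := hS.mul_left c⁻¹
    refine this.congr fun i => ?_
    rw [inv_mul_cancel_left₀ hc.ne', dist_eq_norm, norm_sub_rev]
  obtain ⟨a, ha⟩ := cauchySeq_tendsto_of_complete hC
  refine ⟨a, ha, fun k => ?_⟩
  have hb : ∀ m, c * ‖y k - y (k + m)‖ ≤ ψ k - ψ (k + m) := by
    intro m
    induction m with
    | zero => simp
    | succ m ih =>
      have h1 := norm_sub_le_norm_sub_add_norm_sub (y k) (y (k + m)) (y (k + m + 1))
      have h2 := h (k + m)
      rw [norm_sub_rev] at h2
      rw [← add_assoc]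
      nlinarith
  have hlim : Tendsto (fun m => c * ‖y k - y (k + m)‖) atTop (𝓝 (c * ‖y k - a‖)) := by
    have : Tendsto (fun m => y (k + m)) atTop (𝓝 a) := by
      simpa only [add_comm k] using (tendsto_add_atTop_iff_nat k).2 ha
    exact ((tendsto_const_nhds.sub this).norm).const_mul c
  exact le_of_tendsto hlim (Eventually.of_forall fun m => (hb m).trans (by linarith [hψ (k + m)]))

lemma le_pow_mul_of_succ_le {u : ℕ → ℝ} {ρ : ℝ} (hρ : 0 ≤ ρ)
    (h : ∀ k, u (k + 1) ≤ ρ * u k) (k : ℕ) : u k ≤ u 0 * ρ ^ k := by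
  induction k with
  | zero => simp
  | succ k ih => calc
      u (k + 1) ≤ ρ * u k := h k
      _ ≤ ρ * (u 0 * ρ ^ k) := by gcongr
      _ = _ := by ring

lemma rpow_mul_natCast_le_one_of_decrease {u : ℕ → ℝ} {c θ : ℝ} (hc : 0 ≤ c) (hθ0 : 0 < θ)
    (hθ1 : θ ≤ 1) (hu : ∀ k, 0 ≤ u k)
    (h : ∀ k, u (k + 1) ≤ u k - c * u k ^ (1 + θ)) (k : ℕ) :
    u k ^ θ * (θ * c * k) ≤ 1 := by
  induction k with
  | zero => simp
  | succ k ih =>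
    have hθc : 0 ≤ θ * c := by positivity
    have hw : 0 ≤ u k ^ θ := Real.rpow_nonneg (hu k) _
    have hw' : 0 ≤ u (k + 1) ^ θ := Real.rpow_nonneg (hu _) _
    rcases (hu k).eq_or_lt with h0 | hpos
    · have h1 : u (k + 1) ≤ 0 := by
        refine (h k).trans ?_
        rw [← h0, Real.zero_rpow (by linarith)]; simp
      rw [le_antisymm h1 (hu _), Real.zero_rpow hθ0.ne']; simp
    have hle : u (k + 1) ≤ u k * (1 + -(c * u k ^ θ)) := by
      have := h k
      rw [Real.rpow_add hpos, Real.rpow_one] at this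
      linarith
    have hnn : 0 ≤ 1 + -(c * u k ^ θ) := by
      by_contra hneg
      push Not at hneg
      nlinarith [hu (k + 1)]
    have h1 : u (k + 1) ^ θ ≤ u k ^ θ * (1 - θ * c * u k ^ θ) := by
      calc u (k + 1) ^ θ ≤ (u k * (1 + -(c * u k ^ θ))) ^ θ :=
            Real.rpow_le_rpow (hu _) hle hθ0.le
        _ = u k ^ θ * (1 + -(c * u k ^ θ)) ^ θ := Real.mul_rpow (hu k) hnn
        _ ≤ u k ^ θ * (1 + θ * -(c * u k ^ θ)) := by
            gcongr
            exact rpow_one_add_le_one_add_mul_self (by linarith) hθ0.le hθ1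
        _ = _ := by ring
    set w := u k ^ θ
    set w' := u (k + 1) ^ θ
    have h2 : w' * (1 + θ * c * w) ≤ w := by
      have hp : 0 ≤ θ * c * w := by positivity
      have := mul_le_mul_of_nonneg_right h1 (show 0 ≤ 1 + θ * c * w by linarith)
      nlinarith [mul_nonneg hw (sq_nonneg (θ * c * w))]
    push_cast
    have hp : 0 < 1 + θ * c * w := by positivity
    refine le_of_mul_le_mul_right ?_ hp
    have := mul_le_mul_of_nonneg_right h2 (show 0 ≤ θ * c * ((k : ℝ) + 1) by positivity)
    nlinarith

lemma sq_div_rpow_le_div {t κ τ s : ℝ} (ht0 : 0 ≤ t) (ht1 : t ≤ 1) (hκ0 : 0 ≤ κ) (hκ1 : κ ≤ 1)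
    (hτ0 : 0 < τ) (hτ1 : τ ≤ 1) (hs0 : 1 / 2 ≤ s) (hs1 : s ≤ 1) :
    (κ / τ * t ^ 2) ^ s ≤ 1 / τ * t := by
  have h1 : κ / τ * t ^ 2 ≤ t ^ 2 / τ := by
    rw [div_mul_eq_mul_div]
    gcongr
    exact mul_le_of_le_one_left (sq_nonneg t) hκ1
  refine (Real.rpow_le_rpow (by positivity) h1 (by linarith)).trans ?_
  rw [Real.div_rpow (sq_nonneg t) hτ0.le, one_div_mul_eq_div]
  have h2 : (t ^ 2) ^ s ≤ t := by
    rw [← Real.rpow_natCast, ← Real.rpow_mul ht0]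
    rcases ht0.eq_or_lt with rfl | ht
    · rw [Real.zero_rpow (by push_cast; linarith)]
    · simpa using Real.rpow_le_rpow_of_exponent_ge (z := 1) ht ht1
        (show (1 : ℝ) ≤ ((2 : ℕ) : ℝ) * s by push_cast; linarith)
  have h3 : τ ≤ τ ^ s := by
    simpa using Real.rpow_le_rpow_of_exponent_ge hτ0 hτ1 hs1
  gcongr

section InertialStep

variable {E : Type*} [NormedAddCommGroup E] [InnerProductSpace ℝ E] [CompleteSpace E]
  {f : E → ℝ} {c u x x' y g : E} {ρ ρ₁ L K s ν b Γ β γ τ : ℝ}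

lemma inertial_step_mem_ball (hL : 0 ≤ L)
    (hlip : ∀ x ∈ Metric.ball c ρ, ∀ y ∈ Metric.ball c ρ,
      ‖gradient f x - gradient f y‖ ≤ L * ‖x - y‖)
    (hc : gradient f c = 0) (hν1 : ν < 1)
    (hβ0 : 0 ≤ β) (hβ1 : β ≤ 1) (hγ0 : 0 ≤ γ) (hγ : γ ≤ Γ) (hτ0 : 0 < τ)
    (hτν : τ * (L * (1 + 2 * Γ)) ≤ 1 - ν)
    (hρ₁ : (4 + 2 * Γ) * ρ₁ ≤ ρ)
    (hu : u ∈ Metric.ball c ρ₁) (hx : x ∈ Metric.ball c ρ₁)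
    (hy : y = x + γ • (x - u)) (hx' : x' = x + β • (x - u) - τ • g)
    (hg : ‖g - gradient f y‖ ≤ ν * ‖g‖) :
    x ∈ Metric.ball c ρ ∧ y ∈ Metric.ball c ρ ∧ x' ∈ Metric.ball c ρ ∧ ‖x - u‖ ≤ 2 * ρ₁ := by
  have hΓ : 0 ≤ Γ := hγ0.trans hγ
  simp only [mem_ball_iff_norm] at hu hx ⊢
  have hρ₁0 : 0 < ρ₁ := (norm_nonneg _).trans_lt hx
  have hd : ‖x - u‖ ≤ 2 * ρ₁ := by
    have := norm_sub_le_norm_sub_add_norm_sub x c u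
    rw [norm_sub_rev c u] at this
    linarith
  have hyc : ‖y - c‖ < (1 + 2 * Γ) * ρ₁ := by
    have h1 : ‖y - c‖ ≤ ‖x - c‖ + γ * ‖x - u‖ := by
      have : y - c = (x - c) + γ • (x - u) := by rw [hy]; abel
      rw [this]
      refine (norm_add_le _ _).trans_eq ?_
      rw [norm_smul, Real.norm_eq_abs, abs_of_nonneg hγ0]
    have h2 : γ * ‖x - u‖ ≤ Γ * (2 * ρ₁) := by gcongr
    linarith
  have hΓρ : 0 ≤ Γ * ρ₁ := by positivity
  have hyρ : ‖y - c‖ < ρ := by nlinarith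
  have hxρ : ‖x - c‖ < ρ := by nlinarith
  refine ⟨hxρ, hyρ, ?_, hd⟩
  have hG : ‖gradient f y‖ ≤ L * ‖y - c‖ := by
    simpa [hc] using hlip y (mem_ball_iff_norm.2 hyρ) c
      (Metric.mem_ball_self ((norm_nonneg _).trans_lt hxρ))
  have hgn : (1 - ν) * ‖g‖ ≤ L * ((1 + 2 * Γ) * ρ₁) := by
    have h1 := norm_le_norm_add_norm_sub (gradient f y) g
    rw [norm_sub_rev] at hg
    have h2 := mul_le_mul_of_nonneg_left hyc.le hL
    linarith
  have hτg : τ * ‖g‖ ≤ ρ₁ := by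
    have h1 := mul_le_mul_of_nonneg_left hgn hτ0.le
    have h2 := mul_le_mul_of_nonneg_right hτν hρ₁0.le
    refine le_of_mul_le_mul_left ?_ (sub_pos.2 hν1)
    nlinarith
  have h1 : ‖x' - c‖ ≤ ‖x - c‖ + β * ‖x - u‖ + τ * ‖g‖ := by
    have : x' - c = (x - c) + β • (x - u) - τ • g := by rw [hx']; abel
    rw [this]
    refine (norm_sub_le _ _).trans ((add_le_add_left (norm_add_le _ _) _).trans_eq ?_)
    rw [norm_smul, norm_smul, Real.norm_eq_abs, Real.norm_eq_abs, abs_of_nonneg hβ0,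
      abs_of_pos hτ0]
  have h2 : β * ‖x - u‖ ≤ ‖x - u‖ := mul_le_of_le_one_left (norm_nonneg _) hβ1
  nlinarith

lemma inertial_step_energy_le (hdiff : ∀ x ∈ Metric.ball c ρ, DifferentiableAt ℝ f x) (hL : 0 ≤ L)
    (hlip : ∀ x ∈ Metric.ball c ρ, ∀ y ∈ Metric.ball c ρ,
      ‖gradient f x - gradient f y‖ ≤ L * ‖x - y‖)
    (hν0 : 0 ≤ ν) (hν1 : ν ≤ 1) (hβ0 : 0 ≤ β) (hβ : β ≤ b) (hγ0 : 0 ≤ γ) (hγ : γ ≤ Γ)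
    (hτ0 : 0 < τ) (hτσ : τ * (L * (1 + Γ)) ≤ (1 - ν - b ^ 2) / 8)
    (hxm : x ∈ Metric.ball c ρ) (hym : y ∈ Metric.ball c ρ) (hxm' : x' ∈ Metric.ball c ρ)
    (hy : y = x + γ • (x - u)) (hx' : x' = x + β • (x - u) - τ • g)
    (hg : ‖g - gradient f y‖ ≤ ν * ‖g‖) :
    f x' + (1 - ν + b ^ 2) / 4 / τ * ‖x' - x‖ ^ 2
      + (1 - ν - b ^ 2) / 8 / τ * (‖x - u‖ ^ 2 + ‖x' - x‖ ^ 2)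
      ≤ f x + (1 - ν + b ^ 2) / 4 / τ * ‖x - u‖ ^ 2 := by
  have hΓ : 0 ≤ Γ := hγ0.trans hγ
  have hxy : ‖x - y‖ ≤ Γ * ‖x - u‖ := by
    have : x - y = -(γ • (x - u)) := by rw [hy]; abel
    rw [this, norm_neg, norm_smul, Real.norm_eq_abs, abs_of_nonneg hγ0]
    gcongr
  have hG : ‖gradient f x - gradient f y‖ ≤ L * Γ * ‖x - u‖ :=
    (hlip x hxm y hym).trans (by rw [mul_assoc]; gcongr)
  have h1 := gradient_quadratic_upper_bound (convex_ball c ρ) hdiff hL hlip hxm hxm'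
  have h2 := inner_inexact_momentum_step_le (d' := x' - x) hτ0 hν0 hν1 hβ0 hβ
    (by rw [hx']; abel) hg hG (by positivity)
  have h3 := mul_le_mul_of_nonneg_left h1 hτ0.le
  have h4 := mul_le_mul_of_nonneg_right hτσ (sq_nonneg ‖x' - x‖)
  have h5 := mul_le_mul_of_nonneg_right hτσ (sq_nonneg ‖x - u‖)
  have hτL : 0 ≤ τ * L := by positivity
  have hτLΓ : 0 ≤ τ * L * Γ := by positivity
  refine le_of_mul_le_mul_left ?_ hτ0
  have e1 : τ * (f x' + (1 - ν + b ^ 2) / 4 / τ * ‖x' - x‖ ^ 2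
      + (1 - ν - b ^ 2) / 8 / τ * (‖x - u‖ ^ 2 + ‖x' - x‖ ^ 2)) =
      τ * f x' + (1 - ν + b ^ 2) / 4 * ‖x' - x‖ ^ 2
      + (1 - ν - b ^ 2) / 8 * (‖x - u‖ ^ 2 + ‖x' - x‖ ^ 2) := by field_simp
  have e2 : τ * (f x + (1 - ν + b ^ 2) / 4 / τ * ‖x - u‖ ^ 2) =
      τ * f x + (1 - ν + b ^ 2) / 4 * ‖x - u‖ ^ 2 := by field_simp
  rw [e1, e2]
  have h6 := mul_nonneg hτL (sq_nonneg ‖x - u‖)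
  have h7 := mul_nonneg hτLΓ (sq_nonneg ‖x - u‖)
  have h8 := mul_nonneg hτLΓ (sq_nonneg ‖x' - x‖)
  linarith

lemma inertial_step_energy_rpow_le (hL : 0 ≤ L)
    (hlip : ∀ x ∈ Metric.ball c ρ, ∀ y ∈ Metric.ball c ρ,
      ‖gradient f x - gradient f y‖ ≤ L * ‖x - y‖)
    (hlow : ∀ x ∈ Metric.ball c ρ, f c ≤ f x) (hK : 0 ≤ K)
    (hKL : ∀ x ∈ Metric.ball c ρ, (f x - f c) ^ s ≤ K * ‖gradient f x‖)
    (hs0 : 1 / 2 ≤ s) (hs1 : s ≤ 1)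
    (hν0 : 0 ≤ ν) (hν1 : ν ≤ 1) (hb : b ^ 2 ≤ 1 - ν)
    (hβ0 : 0 ≤ β) (hβ1 : β ≤ 1) (hγ0 : 0 ≤ γ) (hγ : γ ≤ Γ)
    (hτ0 : 0 < τ) (hτ1 : τ ≤ 1) (hτσ : τ * (L * Γ) ≤ 1)
    (hxm : x ∈ Metric.ball c ρ) (hym : y ∈ Metric.ball c ρ) (hd1 : ‖x - u‖ ≤ 1)
    (hy : y = x + γ • (x - u)) (hx' : x' = x + β • (x - u) - τ • g)
    (hg : ‖g - gradient f y‖ ≤ ν * ‖g‖) :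
    (f x - f c + (1 - ν + b ^ 2) / 4 / τ * ‖x - u‖ ^ 2) ^ s
      ≤ (3 * K + 1) / τ * (‖x - u‖ + ‖x' - x‖) := by
  have hΓ : 0 ≤ Γ := hγ0.trans hγ
  have hxy : ‖x - y‖ ≤ Γ * ‖x - u‖ := by
    have : x - y = -(γ • (x - u)) := by rw [hy]; abel
    rw [this, norm_neg, norm_smul, Real.norm_eq_abs, abs_of_nonneg hγ0]
    gcongr
  have hG : ‖gradient f x - gradient f y‖ ≤ L * Γ * ‖x - u‖ :=
    (hlip x hxm y hym).trans (by rw [mul_assoc]; gcongr)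
  have hτg : τ * ‖g‖ ≤ ‖x - u‖ + ‖x' - x‖ := by
    have : τ • g = β • (x - u) - (x' - x) := by rw [hx']; abel
    have h := norm_sub_le (β • (x - u)) (x' - x)
    rw [← this, norm_smul, norm_smul, Real.norm_eq_abs, Real.norm_eq_abs, abs_of_pos hτ0,
      abs_of_nonneg hβ0] at h
    exact h.trans (by gcongr; exact mul_le_of_le_one_left (norm_nonneg _) hβ1)
  have hGn : τ * ‖gradient f x‖ ≤ 3 * (‖x - u‖ + ‖x' - x‖) := by
    have h1 : ‖gradient f x‖ ≤ L * Γ * ‖x - u‖ + 2 * ‖g‖ := by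
      have h2 := norm_le_norm_add_norm_sub' (gradient f x) (gradient f y)
      have h3 := norm_le_norm_add_norm_sub (gradient f y) g
      have h4 : ν * ‖g‖ ≤ ‖g‖ := mul_le_of_le_one_left (norm_nonneg _) hν1
      have h5 := norm_le_norm_add_norm_sub' (gradient f y) g
      rw [norm_sub_rev] at hg
      linarith
    have h2 := mul_le_mul_of_nonneg_left h1 hτ0.le
    have h3 := mul_le_mul_of_nonneg_right hτσ (norm_nonneg (x - u))
    have := norm_nonneg (x' - x)
    nlinarith
  have hb2 := sq_nonneg b
  have hsq := sq_div_rpow_le_div (κ := (1 - ν + b ^ 2) / 4) (norm_nonneg (x - u)) hd1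
    (by linarith) (by linarith) hτ0 hτ1 hs0 hs1
  have hK1 : K * ‖gradient f x‖ ≤ 3 * K / τ * (‖x - u‖ + ‖x' - x‖) := by
    rw [div_mul_eq_mul_div, le_div_iff₀ hτ0]
    nlinarith [mul_le_mul_of_nonneg_left hGn hK]
  calc _ ≤ (f x - f c) ^ s + ((1 - ν + b ^ 2) / 4 / τ * ‖x - u‖ ^ 2) ^ s :=
        Real.rpow_add_le_add_rpow (sub_nonneg.2 (hlow x hxm))
          (mul_nonneg (div_nonneg (by linarith) hτ0.le) (sq_nonneg _)) (by linarith) hs1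
    _ ≤ 3 * K / τ * (‖x - u‖ + ‖x' - x‖) + 1 / τ * ‖x - u‖ :=
        add_le_add ((hKL x hxm).trans hK1) hsq
    _ ≤ 3 * K / τ * (‖x - u‖ + ‖x' - x‖) + 1 / τ * (‖x - u‖ + ‖x' - x‖) := by
        gcongr; exact le_add_of_nonneg_right (norm_nonneg _)
    _ = _ := by ring

end InertialStep

lemma exists_linear_bound_of_decrease {u : ℕ → ℝ} {c : ℝ} (hc : 0 < c) (hu : ∀ k, 0 ≤ u k)
    (h : ∀ k, u (k + 1) ≤ u k - c * u k) :
    ∃ C > (0 : ℝ), ∃ ω ∈ Set.Ioo (0 : ℝ) 1, ∀ k : ℕ,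
      u (k - 1) ≤ C * ω ^ k ∧ u (k - 1) ^ (1 / 2 : ℝ) ≤ C * ω ^ k := by
  set ρ := max (1 - c) (1 / 2)
  have hρ0 : 0 < ρ := lt_max_of_lt_right (by norm_num)
  have hρ1 : ρ < 1 := max_lt (by linarith) (by norm_num)
  have hlin := le_pow_mul_of_succ_le (u := u) hρ0.le fun k =>
    (h k).trans (by nlinarith [hu k, le_max_left (1 - c) (1 / 2)])
  set ω := √ρ
  have hω0 : 0 < ω := Real.sqrt_pos.2 hρ0
  have hω1 : ω < 1 := by rw [Real.sqrt_lt' one_pos]; simpa using hρ1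
  have hωsq : ω ^ 2 = ρ := Real.sq_sqrt hρ0.le
  set C₀ := u 0 + √(u 0) + 1
  have hC₀ : 0 < C₀ := by have := hu 0; positivity
  have hbound : ∀ k, u k ≤ C₀ * ω ^ k ∧ u k ^ (1 / 2 : ℝ) ≤ C₀ * ω ^ k := by
    intro k
    have h1 := hlin k
    rw [← hωsq, ← pow_mul, mul_comm 2 k, pow_mul] at h1
    have hp0 : 0 ≤ ω ^ k := by positivity
    have hp1 : ω ^ k ≤ 1 := pow_le_one₀ hω0.le hω1.le
    have hs := Real.sqrt_nonneg (u 0)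
    constructor
    · refine h1.trans (mul_le_mul (by linarith) ?_ (by positivity) hC₀.le)
      nlinarith
    · rw [← Real.sqrt_eq_rpow]
      calc √(u k) ≤ √(u 0 * (ω ^ k) ^ 2) := Real.sqrt_le_sqrt h1
        _ = √(u 0) * ω ^ k := by rw [Real.sqrt_mul (hu 0), Real.sqrt_sq hp0]
        _ ≤ _ := by gcongr; linarith [hu 0]
  have hshift : ∀ k, C₀ * ω ^ (k - 1) ≤ C₀ / ω * ω ^ k := by
    intro k
    rcases k with _ | k
    · simpa using (le_div_iff₀ hω0).2 (mul_le_of_le_one_right hC₀.le hω1.le)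
    · simp only [Nat.add_sub_cancel]
      rw [pow_succ', ← mul_assoc, div_mul_cancel₀ _ hω0.ne']
  exact ⟨C₀ / ω, by positivity, ω, ⟨hω0, hω1⟩, fun k =>
    ⟨(hbound _).1.trans (hshift k), (hbound _).2.trans (hshift k)⟩⟩

lemma exists_sublinear_bound_of_decrease {u : ℕ → ℝ} {c q : ℝ} (hc : 0 < c) (hq : 1 / 2 < q)
    (hq1 : q < 1) (hu : ∀ k, 0 ≤ u k) (h : ∀ k, u (k + 1) ≤ u k - c * u k ^ (2 * q)) :
    ∃ C > (0 : ℝ), ∀ k : ℕ, 2 ≤ k →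
      u (k - 1) ≤ C * (k : ℝ) ^ (-(2 - 2 * q) / (2 * q - 1)) ∧
      u (k - 1) ^ (1 - q) ≤ C * (k : ℝ) ^ (-(1 - q) / (2 * q - 1)) := by
  have hθ0 : 0 < 2 * q - 1 := by linarith
  have hrate := rpow_mul_natCast_le_one_of_decrease (u := u) (θ := 2 * q - 1) hc.le hθ0
    (by linarith) hu (by simpa using h)
  set D := 2 / ((2 * q - 1) * c)
  have hD : 0 < D := by positivity
  have hpow : ∀ k : ℕ, 2 ≤ k → ∀ e : ℝ, 0 ≤ e →
      u (k - 1) ^ e ≤ D ^ (e / (2 * q - 1)) * (k : ℝ) ^ (-e / (2 * q - 1)) := by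
    intro k hk e he
    have hk2 : (2 : ℝ) ≤ k := by exact_mod_cast hk
    have hk0 : (0 : ℝ) < k := by linarith
    have h1 := hrate (k - 1)
    rw [Nat.cast_sub (by omega), Nat.cast_one] at h1
    have hw : 0 ≤ u (k - 1) ^ (2 * q - 1) := Real.rpow_nonneg (hu _) _
    have h2 : u (k - 1) ^ (2 * q - 1) ≤ D / k := by
      rw [div_div, le_div_iff₀ (by positivity)]
      have : 0 ≤ u (k - 1) ^ (2 * q - 1) * ((2 * q - 1) * c) := by positivity
      nlinarith
    calc u (k - 1) ^ e = (u (k - 1) ^ (2 * q - 1)) ^ (e / (2 * q - 1)) := by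
          rw [← Real.rpow_mul (hu _), mul_div_cancel₀ _ hθ0.ne']
      _ ≤ (D / k) ^ (e / (2 * q - 1)) := Real.rpow_le_rpow hw h2 (by positivity)
      _ = _ := by
          rw [Real.div_rpow hD.le hk0.le, neg_div, Real.rpow_neg hk0.le, div_eq_mul_inv]
  refine ⟨D ^ (1 / (2 * q - 1)) + D ^ ((1 - q) / (2 * q - 1)), by positivity, fun k hk => ⟨?_, ?_⟩⟩
  · have h1 := hpow k hk 1 zero_le_one
    rw [Real.rpow_one] at h1
    have hk1 : (1 : ℝ) ≤ k := by exact_mod_cast (by omega : 1 ≤ k)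
    refine h1.trans (mul_le_mul (le_add_of_nonneg_right (by positivity)) ?_ (by positivity)
      (by positivity))
    refine Real.rpow_le_rpow_of_exponent_le hk1 ?_
    gcongr
    linarith
  · refine (hpow k hk (1 - q) (by linarith)).trans ?_
    gcongr
    exact le_add_of_nonneg_left (by positivity)

lemma ExpPLKCondition.exists_ball {n : ℕ} {f : EuclideanSpace ℝ (Fin n) → ℝ}
    {c : EuclideanSpace ℝ (Fin n)} {M q r : ℝ} (h : ExpPLKCondition f c M q) (hM : 0 ≤ M)
    (hq0 : 0 < q) (hq1 : q < 1) (hf : ContinuousAt f c) (hmin : IsLocalMin f c) (hr : 0 < r) :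
    ∃ ρ, 0 < ρ ∧ ρ ≤ r ∧ ρ ≤ 1 ∧ (∀ x ∈ Metric.ball c ρ, f c ≤ f x) ∧
      ∀ x ∈ Metric.ball c ρ, (f x - f c) ^ max q (1 / 2) ≤ M * (1 - q) * ‖gradient f x‖ := by
  obtain ⟨η, U, hη, hU, hPLK⟩ := h
  have hlt : ∀ᶠ x in 𝓝 c, f x < f c + min η 1 :=
    hf.eventually_lt_const (by linarith [lt_min hη one_pos])
  obtain ⟨ε, hε, hball⟩ := Metric.eventually_nhds_iff_ball.1 ((hmin.and hlt).and hU)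
  refine ⟨min ε (min r 1), lt_min hε (lt_min hr one_pos),
    (min_le_right _ _).trans (min_le_left _ _), (min_le_right _ _).trans (min_le_right _ _),
    fun x hx => (hball x (Metric.ball_subset_ball (min_le_left _ _) hx)).1.1, fun x hx => ?_⟩
  obtain ⟨⟨h1, h2⟩, h3⟩ := hball x (Metric.ball_subset_ball (min_le_left _ _) hx)
  have hs0 : 0 < max q (1 / 2) := lt_max_of_lt_left hq0
  have hrhs : 0 ≤ M * (1 - q) * ‖gradient f x‖ :=
    mul_nonneg (mul_nonneg hM (by linarith)) (norm_nonneg _)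
  rcases h1.eq_or_lt with h0 | h0
  · rwa [h0, sub_self, Real.zero_rpow hs0.ne']
  have hpos : 0 < f x - f c := sub_pos.2 h0
  have hle1 : f x - f c ≤ 1 := by linarith [min_le_right η 1]
  have h4 := hPLK x h3 h0 (by linarith [min_le_left η 1])
  rw [Real.rpow_neg hpos.le] at h4
  have h5 : (f x - f c) ^ q ≤ M * (1 - q) * ‖gradient f x‖ := by
    have hp := Real.rpow_pos_of_pos hpos q
    have h6 := mul_le_mul_of_nonneg_right h4 hp.le
    rw [one_mul] at h6
    refine h6.trans_eq ?_
    field_simp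
  exact (Real.rpow_le_rpow_of_exponent_ge hpos hle1 (le_max_left _ _)).trans h5

section InertialSequence

variable {E : Type*} [NormedAddCommGroup E] {f : E → ℝ} {c : E} {x : ℕ → E}
  {ρ ρ₁ s σ κ A τ : ℝ}

/-- The value gap of the iterate `x (k + 1)` plus a multiple of the last squared increment. -/
noncomputable def inertialEnergy (f : E → ℝ) (c : E) (κ : ℝ) (x : ℕ → E) (k : ℕ) : ℝ :=
  f (x (k + 1)) - f c + κ * ‖x (k + 1) - x k‖ ^ 2

lemma inertialEnergy_nonneg (hκ : 0 ≤ κ) {k : ℕ} (h : f c ≤ f (x (k + 1))) :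
    0 ≤ inertialEnergy f c κ x k :=
  add_nonneg (sub_nonneg.2 h) (by positivity)

lemma mem_ball_of_inertialEnergy_step (hs0 : 0 < s) (hs1 : s < 1) (hσ : 0 < σ) (hA : 0 < A)
    (hτ : 0 < τ) (hκ : 0 ≤ κ) (hlow : ∀ x ∈ Metric.ball c ρ, f c ≤ f x)
    (hx0 : x 0 = x 1) (hx1 : ‖x 1 - c‖ < ρ₁ / 2)
    (hinit : (f (x 1) - f c) ^ (1 - s) ≤ (1 - s) * σ / (2 * A) * (ρ₁ / 2))
    (hstep : ∀ k, x k ∈ Metric.ball c ρ₁ → x (k + 1) ∈ Metric.ball c ρ₁ →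
      x (k + 2) ∈ Metric.ball c ρ ∧
      inertialEnergy f c κ x (k + 1)
        + σ / τ * (‖x (k + 1) - x k‖ ^ 2 + ‖x (k + 2) - x (k + 1)‖ ^ 2)
        ≤ inertialEnergy f c κ x k ∧
      inertialEnergy f c κ x k ^ s
        ≤ A / τ * (‖x (k + 1) - x k‖ + ‖x (k + 2) - x (k + 1)‖)) (k : ℕ) :
    x k ∈ Metric.ball c ρ₁ := by
  set c₀ := (1 - s) * σ / (2 * A)
  have hs : 0 < 1 - s := sub_pos.2 hs1
  have hc₀ : 0 < c₀ := by positivity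
  have hρ₁ : 0 < ρ₁ := by linarith [norm_nonneg (x 1 - c)]
  have hxm1 : x 1 ∈ Metric.ball c ρ₁ := mem_ball_iff_norm.2 (by linarith)
  have key : ∀ k, x k ∈ Metric.ball c ρ₁ ∧ x (k + 1) ∈ Metric.ball c ρ₁ ∧
      c₀ * ‖x (k + 1) - x 1‖ + inertialEnergy f c κ x k ^ (1 - s)
        ≤ (f (x 1) - f c) ^ (1 - s) := by
    intro k
    induction k with
    | zero => exact ⟨hx0 ▸ hxm1, hxm1, by simp [inertialEnergy, hx0]⟩
    | succ k ih =>
      obtain ⟨h1, h2, h3⟩ := ih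
      obtain ⟨h4, h5, h6⟩ := hstep k h1 h2
      have hnn : 0 ≤ inertialEnergy f c κ x (k + 1) := inertialEnergy_nonneg hκ (hlow _ h4)
      have h7 := rpow_sub_rpow_ge_of_sufficient_decrease hs0 hs1.le hnn (norm_nonneg _)
        (norm_nonneg _) hσ hA hτ h5 h6
      have h8 : c₀ * ‖x (k + 2) - x 1‖ + inertialEnergy f c κ x (k + 1) ^ (1 - s)
          ≤ (f (x 1) - f c) ^ (1 - s) := by
        have h9 := mul_le_mul_of_nonneg_left
          (norm_sub_le_norm_sub_add_norm_sub (x (k + 2)) (x (k + 1)) (x 1)) hc₀.le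
        have h10 := mul_nonneg hc₀.le (norm_nonneg (x (k + 1) - x k))
        linarith
      refine ⟨h2, mem_ball_iff_norm.2 ?_, h8⟩
      have h9 : ‖x (k + 2) - x 1‖ ≤ ρ₁ / 2 := by
        refine le_of_mul_le_mul_left ?_ hc₀
        linarith [Real.rpow_nonneg hnn (1 - s)]
      linarith [norm_sub_le_norm_sub_add_norm_sub (x (k + 2)) (x 1) c]
  exact (key k).1

lemma exists_tendsto_of_inertialEnergy [CompleteSpace E] (hs0 : 0 < s) (hs1 : s < 1) (hσ : 0 < σ) (hA : 0 < A)
    (hτ : 0 < τ) (hκ : 0 ≤ κ) (hρ : ρ₁ < ρ) (hlow : ∀ x ∈ Metric.ball c ρ, f c ≤ f x)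
    (hcont : ∀ x ∈ Metric.ball c ρ, ContinuousAt f x)
    (hmem : ∀ k, x k ∈ Metric.ball c ρ₁)
    (hdec : ∀ k, inertialEnergy f c κ x (k + 1)
        + σ / τ * (‖x (k + 1) - x k‖ ^ 2 + ‖x (k + 2) - x (k + 1)‖ ^ 2)
        ≤ inertialEnergy f c κ x k)
    (hKL : ∀ k, inertialEnergy f c κ x k ^ s
        ≤ A / τ * (‖x (k + 1) - x k‖ + ‖x (k + 2) - x (k + 1)‖)) :
    ∃ a ∈ Metric.ball c ρ, Tendsto x atTop (𝓝 a) ∧ f a = f c ∧ ∀ k,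
      (1 - s) * σ / (2 * A) * ‖x (k + 1) - a‖ ≤ inertialEnergy f c κ x k ^ (1 - s) := by
  have hs : 0 < 1 - s := sub_pos.2 hs1
  have hlow' : ∀ k, f c ≤ f (x k) := fun k => hlow _ (Metric.ball_subset_ball hρ.le (hmem k))
  have hnn : ∀ k, 0 ≤ inertialEnergy f c κ x k := fun k => inertialEnergy_nonneg hκ (hlow' _)
  have hc₀ : 0 < (1 - s) * σ / (2 * A) := by positivity
  obtain ⟨a, ha, hbound⟩ := exists_tendsto_of_norm_sub_le_sub (y := fun k => x (k + 1)) hc₀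
    (fun k => Real.rpow_nonneg (hnn k) (1 - s)) (fun k => by
      have h := rpow_sub_rpow_ge_of_sufficient_decrease hs0 hs1.le (hnn (k + 1)) (norm_nonneg _)
        (norm_nonneg _) hσ hA hτ (hdec k) (hKL k)
      refine le_trans ?_ h
      gcongr
      exact le_add_of_nonneg_left (norm_nonneg _))
  have hxa : Tendsto x atTop (𝓝 a) := (tendsto_add_atTop_iff_nat 1).1 ha
  have hab : a ∈ Metric.ball c ρ := Metric.closedBall_subset_ball hρ <|
    Metric.isClosed_closedBall.mem_of_tendsto hxa
      (Eventually.of_forall fun k => Metric.ball_subset_closedBall (hmem k))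
  have hd : Tendsto (fun k => ‖x (k + 1) - x k‖) atTop (𝓝 0) := by
    simpa using (ha.sub hxa).norm
  have hpow : Tendsto (fun k => inertialEnergy f c κ x k ^ s) atTop (𝓝 0) := by
    refine squeeze_zero (fun k => Real.rpow_nonneg (hnn k) s) hKL ?_
    simpa using (hd.add ((tendsto_add_atTop_iff_nat 1).2 hd)).const_mul (A / τ)
  have hE : Tendsto (fun k => inertialEnergy f c κ x k) atTop (𝓝 0) := by
    have h := hpow.rpow_const (p := s⁻¹) (Or.inr (by positivity))
    rw [Real.zero_rpow (by positivity)] at h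
    refine h.congr fun k => ?_
    rw [← Real.rpow_mul (hnn k), mul_inv_cancel₀ hs0.ne', Real.rpow_one]
  have hfa : Tendsto (fun k => f (x (k + 1)) - f c) atTop (𝓝 0) :=
    squeeze_zero (fun k => sub_nonneg.2 (hlow' _))
      (fun k => le_add_of_nonneg_right (by positivity)) hE
  have hfa' : Tendsto (fun k => f (x (k + 1)) - f c) atTop (𝓝 (f a - f c)) :=
    ((hcont a hab).tendsto.comp ha).sub_const _
  exact ⟨a, hab, hxa, by linarith [tendsto_nhds_unique hfa hfa'], hbound⟩

lemma inertialEnergy_succ_le_sub_rpow (hσ : 0 < σ) (hA : 0 < A) (hτ : 0 < τ) {k : ℕ}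
    (hnn : 0 ≤ inertialEnergy f c κ x k)
    (hdec : inertialEnergy f c κ x (k + 1)
        + σ / τ * (‖x (k + 1) - x k‖ ^ 2 + ‖x (k + 2) - x (k + 1)‖ ^ 2)
        ≤ inertialEnergy f c κ x k)
    (hKL : inertialEnergy f c κ x k ^ s
        ≤ A / τ * (‖x (k + 1) - x k‖ + ‖x (k + 2) - x (k + 1)‖)) :
    inertialEnergy f c κ x (k + 1) ≤ inertialEnergy f c κ x k
      - σ * τ / (2 * A ^ 2) * inertialEnergy f c κ x k ^ (2 * s) := by
  set a := ‖x (k + 1) - x k‖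
  set b := ‖x (k + 2) - x (k + 1)‖
  have h1 : inertialEnergy f c κ x k ^ (2 * s) ≤ (A / τ) ^ 2 * (2 * (a ^ 2 + b ^ 2)) := by
    rw [mul_comm, Real.rpow_mul hnn, Real.rpow_two]
    calc _ ≤ (A / τ * (a + b)) ^ 2 := pow_le_pow_left₀ (Real.rpow_nonneg hnn _) hKL 2
      _ = (A / τ) ^ 2 * (a + b) ^ 2 := mul_pow _ _ _
      _ ≤ _ := by gcongr; nlinarith [sq_nonneg (a - b)]
  have h2 := mul_le_mul_of_nonneg_left h1 (show 0 ≤ σ * τ / (2 * A ^ 2) by positivity)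
  have h3 : σ * τ / (2 * A ^ 2) * ((A / τ) ^ 2 * (2 * (a ^ 2 + b ^ 2)))
      = σ / τ * (a ^ 2 + b ^ 2) := by field_simp
  linarith

end InertialSequence

/-- Local convergence rates of IGDm around a local minimizer `xb` of `f` satisfying the
exponential PLK condition with exponent `q ∈ (0,1)`. -/
theorem IGDm_local_rates_expPLK {n : ℕ}
    (f : EuclideanSpace ℝ (Fin n) → ℝ)
    (r : ℝ) (hr : 0 < r)
    (xb : EuclideanSpace ℝ (Fin n))
    (hdiff : ∀ x ∈ Metric.ball xb r, DifferentiableAt ℝ f x)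
    (L : ℝ) (hL : 0 < L)
    (hlip : ∀ x ∈ Metric.ball xb r, ∀ y ∈ Metric.ball xb r,
      ‖gradient f x - gradient f y‖ ≤ L * ‖x - y‖)
    (hmin : IsLocalMin f xb)
    (M q : ℝ) (hM : 0 < M) (hq : q ∈ Set.Ioo (0:ℝ) 1)
    (hPLK : ExpPLKCondition f xb M q)
    (ν βbar δbar : ℝ) (hν : ν ∈ Set.Ioo (0:ℝ) 1)
    (hβbar : 0 ≤ βbar) (hβbar' : βbar < Real.sqrt (1 - ν))
    (β γ : ℕ → ℝ) (hβnn : ∀ k, 0 ≤ β k) (hγnn : ∀ k, 0 ≤ γ k)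
    (hβb : ∀ k, β k ≤ βbar) (hδb : ∀ k, |β k - γ k| ≤ δbar) :
    ∃ ξ T : ℝ, 0 < ξ ∧ ξ ≤ r ∧ 0 < T ∧
      ∀ τ : ℝ, 0 < τ → τ ≤ T →
      ∀ x xin xex g : ℕ → EuclideanSpace ℝ (Fin n),
        x 0 = x 1 → x 1 ∈ Metric.ball xb ξ →
        (∀ k, 1 ≤ k → xin k = x k + β k • (x k - x (k-1))) →
        (∀ k, 1 ≤ k → xex k = x k + γ k • (x k - x (k-1))) →
        (∀ k, 1 ≤ k → x (k+1) = xin k - τ • g k) →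
        (∀ k, 1 ≤ k → ‖g k - gradient f (xex k)‖ ≤ ν * ‖g k‖) →
        (∀ k, 1 ≤ k → gradient f (xex k) ≠ 0) →
        ∃ xt : EuclideanSpace ℝ (Fin n),
          IsLocalMin f xt ∧ f xt = f xb ∧
          Tendsto x atTop (nhds xt) ∧
          (q = 1/2 → ∃ C > (0:ℝ), ∃ c ∈ Set.Ioo (0:ℝ) 1, ∀ k : ℕ,
            ‖x k - xt‖ ≤ C * c ^ k ∧ ‖gradient f (x k)‖ ≤ C * c ^ k ∧
            |f (x k) - f xt| ≤ C * c ^ k) ∧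
          (1/2 < q → ∃ C > (0:ℝ), ∃ N : ℕ, ∀ k ≥ N,
            ‖x k - xt‖ ≤ C * (k : ℝ) ^ (-(1 - q) / (2*q - 1)) ∧
            ‖gradient f (x k)‖ ≤ C * (k : ℝ) ^ (-(1 - q) / (2*q - 1)) ∧
            f (x k) - f xt ≤ C * (k : ℝ) ^ (-(2 - 2*q) / (2*q - 1))) := by
  obtain ⟨hν0, hν1⟩ := hν
  obtain ⟨hq0, hq1⟩ := hq
  have hxbr : xb ∈ Metric.ball xb r := Metric.mem_ball_self hr
  have hgrad : gradient f xb = 0 := hmin.gradient_eq_zero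
  have hfc : ContinuousAt f xb := (hdiff xb hxbr).continuousAt
  obtain ⟨ρ, hρ0, hρr, hρ1, hlow, hKL⟩ := hPLK.exists_ball hM.le hq0 hq1 hfc hmin hr
  have hsub : Metric.ball xb ρ ⊆ Metric.ball xb r := Metric.ball_subset_ball hρr
  have hdiff' : ∀ x ∈ Metric.ball xb ρ, DifferentiableAt ℝ f x := fun x hx => hdiff x (hsub hx)
  have hlip' : ∀ x ∈ Metric.ball xb ρ, ∀ y ∈ Metric.ball xb ρ,
      ‖gradient f x - gradient f y‖ ≤ L * ‖x - y‖ :=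
    fun x hx y hy => hlip x (hsub hx) y (hsub hy)
  set s := max q (1 / 2) with hs
  have hs0 : 1 / 2 ≤ s := le_max_right _ _
  have hs1 : s < 1 := max_lt hq1 (by norm_num)
  have hs1' : 0 < 1 - s := sub_pos.2 hs1
  have hb : βbar ^ 2 < 1 - ν := (Real.lt_sqrt hβbar).1 hβbar'
  have hb0 : 0 ≤ βbar ^ 2 := sq_nonneg _
  have hβ1 : ∀ k, β k ≤ 1 := fun k => (hβb k).trans (by nlinarith)
  set Γ := βbar + δbar
  have hγ : ∀ k, γ k ≤ Γ := fun k => by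
    have h1 := neg_le_of_abs_le (hδb k)
    have h2 := hβb k
    change γ k ≤ βbar + δbar
    linarith
  have hΓ : 0 ≤ Γ := (hγnn 0).trans (hγ 0)
  set σ := (1 - ν - βbar ^ 2) / 8 with hσdef
  have hσ : 0 < σ := by rw [hσdef]; linarith
  have hκ₀ : 0 ≤ (1 - ν + βbar ^ 2) / 4 := by linarith
  set K := M * (1 - q)
  have hK : 0 ≤ K := mul_nonneg hM.le (by linarith)
  have hA : 0 < 3 * K + 1 := by linarith
  set c₀ := (1 - s) * σ / (2 * (3 * K + 1))
  have hc₀ : 0 < c₀ := by positivity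
  set ρ₁ := ρ / (4 + 2 * Γ)
  have hρ₁0 : 0 < ρ₁ := by positivity
  have hρ₁ : (4 + 2 * Γ) * ρ₁ = ρ := mul_div_cancel₀ _ (by positivity)
  have hρ₁ρ : 4 * ρ₁ ≤ ρ := by nlinarith [mul_nonneg hΓ hρ₁0.le]
  have hinit : ∀ᶠ x in 𝓝 xb, (f x - f xb) ^ (1 - s) < c₀ * (ρ₁ / 2) := by
    have h1 : ContinuousAt (fun x => (f x - f xb) ^ (1 - s)) xb :=
      (hfc.sub continuousAt_const).rpow_const (Or.inr hs1'.le)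
    refine h1.eventually_lt_const ?_
    simp only [sub_self, Real.zero_rpow hs1'.ne']
    positivity
  obtain ⟨ε, hε, hball⟩ := Metric.eventually_nhds_iff_ball.1 hinit
  have hL1 : 0 < L * (1 + Γ) := by positivity
  have hL2 : 0 < L * (1 + 2 * Γ) := by positivity
  refine ⟨min ε (ρ₁ / 2), min 1 (min (σ / (L * (1 + Γ))) ((1 - ν) / (L * (1 + 2 * Γ)))),
    lt_min hε (by linarith), (min_le_right _ _).trans (by linarith),
    lt_min one_pos (lt_min (by positivity) (div_pos (by linarith) hL2)), ?_⟩
  intro τ hτ0 hτT x xin xex g hx01 hx1 hxin hxex hxs hg _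
  obtain ⟨hτ1, hτ⟩ := le_min_iff.1 hτT
  have hτσ : τ * (L * (1 + Γ)) ≤ σ := (le_div_iff₀ hL1).1 (hτ.trans (min_le_left _ _))
  have hτν : τ * (L * (1 + 2 * Γ)) ≤ 1 - ν := (le_div_iff₀ hL2).1 (hτ.trans (min_le_right _ _))
  have hτΓ : τ * (L * Γ) ≤ 1 := by
    have : 0 < τ * L := by positivity
    linarith
  have hκ : 0 ≤ (1 - ν + βbar ^ 2) / 4 / τ := div_nonneg hκ₀ hτ0.le
  have hstep : ∀ k, x k ∈ Metric.ball xb ρ₁ → x (k + 1) ∈ Metric.ball xb ρ₁ →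
      x (k + 2) ∈ Metric.ball xb ρ ∧
      inertialEnergy f xb ((1 - ν + βbar ^ 2) / 4 / τ) x (k + 1)
        + σ / τ * (‖x (k + 1) - x k‖ ^ 2 + ‖x (k + 2) - x (k + 1)‖ ^ 2)
        ≤ inertialEnergy f xb ((1 - ν + βbar ^ 2) / 4 / τ) x k ∧
      inertialEnergy f xb ((1 - ν + βbar ^ 2) / 4 / τ) x k ^ s
        ≤ (3 * K + 1) / τ * (‖x (k + 1) - x k‖ + ‖x (k + 2) - x (k + 1)‖) := by
    intro k hk hk'
    have hy : xex (k + 1) = x (k + 1) + γ (k + 1) • (x (k + 1) - x k) :=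
      hxex (k + 1) (by omega)
    have hx' : x (k + 2) = x (k + 1) + β (k + 1) • (x (k + 1) - x k) - τ • g (k + 1) := by
      rw [hxs (k + 1) (by omega), hxin (k + 1) (by omega), Nat.add_sub_cancel]
    have hgk := hg (k + 1) (by omega)
    obtain ⟨hm1, hm2, hm3, hd⟩ := inertial_step_mem_ball hL.le hlip' hgrad hν1 (hβnn _) (hβ1 _)
      (hγnn _) (hγ _) hτ0 hτν hρ₁.le hk hk' hy hx' hgk
    have hE := inertial_step_energy_le hdiff' hL.le hlip' hν0.le hν1.le (hβnn _) (hβb _)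
      (hγnn _) (hγ _) hτ0 hτσ hm1 hm2 hm3 hy hx' hgk
    refine ⟨hm3, ?_, inertial_step_energy_rpow_le hL.le hlip' hlow hK hKL hs0 hs1.le hν0.le hν1.le
      hb.le (hβnn _) (hβ1 _) (hγnn _) (hγ _) hτ0 hτ1 hτΓ hm1 hm2 (by linarith) hy hx' hgk⟩
    simp only [inertialEnergy]
    linarith
  have hx1ε : x 1 ∈ Metric.ball xb ε := Metric.ball_subset_ball (min_le_left _ _) hx1
  have hx1ρ : ‖x 1 - xb‖ < ρ₁ / 2 :=
    mem_ball_iff_norm.1 (Metric.ball_subset_ball (min_le_right _ _) hx1)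
  have hmem := mem_ball_of_inertialEnergy_step (by linarith) hs1 hσ hA hτ0 hκ hlow hx01 hx1ρ
    (hball _ hx1ε).le hstep
  have hdec := fun k => (hstep k (hmem k) (hmem (k + 1))).2.1
  have hKLk := fun k => (hstep k (hmem k) (hmem (k + 1))).2.2
  obtain ⟨xt, hxt, htend, hfxt, hbound⟩ := exists_tendsto_of_inertialEnergy (by linarith) hs1 hσ hA
    hτ0 hκ (by linarith) hlow (fun x hx => (hdiff' x hx).continuousAt) hmem hdec hKLk
  set Φ := inertialEnergy f xb ((1 - ν + βbar ^ 2) / 4 / τ) x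
  have hmemρ : ∀ k, x k ∈ Metric.ball xb ρ :=
    fun k => Metric.ball_subset_ball (by linarith) (hmem k)
  have hΦ : ∀ k, 0 ≤ Φ k := fun k => inertialEnergy_nonneg hκ (hlow _ (hmemρ _))
  have hxtmin : IsLocalMin f xt := by
    filter_upwards [Metric.isOpen_ball.mem_nhds hxt] with z hz
    rw [hfxt]
    exact hlow z hz
  have hxk : ∀ k, x (k - 1 + 1) = x k := by
    rintro (_ | k)
    · exact hx01.symm
    · rfl
  have hdist : ∀ k, ‖x k - xt‖ ≤ c₀⁻¹ * Φ (k - 1) ^ (1 - s) := fun k => by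
    have h := hbound (k - 1)
    rw [hxk] at h
    rwa [inv_mul_eq_div, le_div_iff₀' hc₀]
  have hgr : ∀ k, ‖gradient f (x k)‖ ≤ L * ‖x k - xt‖ := fun k => by
    simpa [hxtmin.gradient_eq_zero] using hlip' _ (hmemρ k) _ hxt
  have hval : ∀ k, |f (x k) - f xt| ≤ Φ (k - 1) := fun k => by
    rw [hfxt, abs_of_nonneg (sub_nonneg.2 (hlow _ (hmemρ k)))]
    have h : f (x (k - 1 + 1)) - f xb ≤ Φ (k - 1) := le_add_of_nonneg_right (by positivity)
    rwa [hxk] at h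
  have hrec := fun k => inertialEnergy_succ_le_sub_rpow hσ hA hτ0 (hΦ k) (hdec k) (hKLk k)
  have hcombine : ∀ {C a b : ℝ} {k : ℕ}, 0 ≤ C → 0 ≤ a → 0 ≤ b →
      Φ (k - 1) ^ (1 - s) ≤ C * a → Φ (k - 1) ≤ C * b →
      ‖x k - xt‖ ≤ (1 + c₀⁻¹ + L * c₀⁻¹) * C * a ∧
      ‖gradient f (x k)‖ ≤ (1 + c₀⁻¹ + L * c₀⁻¹) * C * a ∧
      |f (x k) - f xt| ≤ (1 + c₀⁻¹ + L * c₀⁻¹) * C * b := by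
    intro C a b k hC ha hb' h1 h2
    have hc : 0 < c₀⁻¹ := inv_pos.2 hc₀
    have hLc : 0 < L * c₀⁻¹ := mul_pos hL hc
    have hCa : 0 ≤ C * a := mul_nonneg hC ha
    have hCb : 0 ≤ C * b := mul_nonneg hC hb'
    have h3 := (hdist k).trans (mul_le_mul_of_nonneg_left h1 hc.le)
    have h4 := (hgr k).trans (mul_le_mul_of_nonneg_left h3 hL.le)
    have h5 := (hval k).trans h2
    have h6 := mul_nonneg hc.le hCa
    have h7 := mul_nonneg hLc.le hCa
    have h8 := mul_nonneg hc.le hCb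
    have h9 := mul_nonneg hLc.le hCb
    refine ⟨?_, ?_, ?_⟩ <;> linarith
  have hcoef : 0 < 1 + c₀⁻¹ + L * c₀⁻¹ := by positivity
  have hrate : 0 < σ * τ / (2 * (3 * K + 1) ^ 2) := by positivity
  refine ⟨xt, hxtmin, hfxt, htend, fun hq2 => ?_, fun hq2 => ?_⟩
  · have hs2 : s = 1 / 2 := by rw [hs, hq2, max_self]
    obtain ⟨C, hC, ω, hω, hlin⟩ := exists_linear_bound_of_decrease hrate hΦ
      (fun k => by simpa [hs2] using hrec k)
    refine ⟨(1 + c₀⁻¹ + L * c₀⁻¹) * C, mul_pos hcoef hC, ω, hω, fun k => ?_⟩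
    have hωk : 0 ≤ ω ^ k := pow_nonneg hω.1.le k
    refine hcombine hC.le hωk hωk ?_ (hlin k).1
    rw [hs2, show (1 : ℝ) - 1 / 2 = 1 / 2 by norm_num]
    exact (hlin k).2
  · have hsq : s = q := max_eq_left hq2.le
    rw [hsq] at hrec hcombine
    obtain ⟨C, hC, hsubl⟩ := exists_sublinear_bound_of_decrease hrate hq2 hq1 hΦ hrec
    refine ⟨(1 + c₀⁻¹ + L * c₀⁻¹) * C, mul_pos hcoef hC, 2, fun k hk => ?_⟩
    obtain ⟨h1, h2, h3⟩ := hcombine hC.le (Real.rpow_nonneg (Nat.cast_nonneg k) _)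
      (Real.rpow_nonneg (Nat.cast_nonneg k) _) (hsubl k hk).2 (hsubl k hk).1
    exact ⟨h1, h2, (le_abs_self _).trans h3⟩
end
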